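/- arXiv:math/0203036 — 6 statements merged into one kernel-verified Lean document; each statement's English description precedes it below -/
import Mathlib

section
/- Let n ≥ 1 and let k be an integer with k ≥ n² + 2n − 2. For all derivations X₁, …, X_k ∈ Derivation ℂ A_n A_n, the ℂ-linear endomorphism s_k(X₁, …, X_k) of A_n equals the endomorphism underlying the derivation s_k^{rsym}(X₁, …, X_k); in particular, s_k(X₁, …, X_k) is itself a derivation of A_n, i.e. s_k is a well-defined k-ary operation on vector fields in n variables. -/
noncomputable section

/-- Vector fields in `n` variables: `ℂ`-derivations of the polynomial ring `A_n`. -/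
abbrev Vect (n : ℕ) : Type :=
  Derivation ℂ (MvPolynomial (Fin n) ℂ) (MvPolynomial (Fin n) ℂ)

/-- `s_k(T₁,…,T_k) = ∑_{σ} (sign σ) • T_{σ(k)} ∘ ⋯ ∘ T_{σ(1)}`, so that `T_{σ(1)}` acts first. -/
def sEnd {A : Type*} [AddCommGroup A] [Module ℂ A] {k : ℕ}
    (T : Fin k → Module.End ℂ A) : Module.End ℂ A :=
  ∑ σ : Equiv.Perm (Fin k),
    (Equiv.Perm.sign σ : ℤ) • (List.ofFn fun i : Fin k => T (σ i)).reverse.prod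

/-- The right-symmetric product `X ∘ᵣ Y` of vector fields: the unique derivation
sending each variable `xᵢ` to `Y (X xᵢ)`. -/
def rsym {n : ℕ} (X Y : Vect n) : Vect n :=
  MvPolynomial.mkDerivation ℂ fun i => Y (X (MvPolynomial.X i))

/-- Left-normed `rsym`-product of a list of vector fields. -/
def leftNormProd {n : ℕ} : List (Vect n) → Vect n
  | [] => 0
  | a :: t => t.foldl rsym a

/-- `s_k^{rsym}(X₁,…,X_k)`: alternating sum of left-normed right-symmetric products. -/
def sRsym {n k : ℕ} (X : Fin k → Vect n) : Vect n :=
  ∑ σ : Equiv.Perm (Fin k),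
    (Equiv.Perm.sign σ : ℤ) • leftNormProd (List.ofFn fun i : Fin k => X (σ i))

/-- Divergence of a vector field. -/
def divg {n : ℕ} (X : Vect n) : MvPolynomial (Fin n) ℂ :=
  ∑ i : Fin n, MvPolynomial.pderiv i (X (MvPolynomial.X i))

end

open MvPolynomial

section S0

theorem multilin_span {ι : Type} [Fintype ι] {V W : Type*} [AddCommGroup V] [Module ℂ V]
    [AddCommGroup W] [Module ℂ W] [DecidableEq ι]
    (Φ : MultilinearMap ℂ (fun _ : ι => V) W) (S : ι → Set V)
    (h : ∀ Y : ι → V, (∀ i, Y i ∈ S i) → Φ Y = 0)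
    (X : ι → V) (hX : ∀ i, X i ∈ Submodule.span ℂ (S i)) : Φ X = 0 := by
  have key : ∀ F : Finset ι, ∀ Y : ι → V, (∀ i ∈ F, Y i ∈ Submodule.span ℂ (S i)) →
      (∀ i ∉ F, Y i ∈ S i) → Φ Y = 0 := by
    intro F
    induction F using Finset.induction_on with
    | empty => intro Y _ h2; exact h Y (fun i => h2 i (by simp))
    | insert j F hj ih =>
      intro Y h1 h2
      have : ∀ v ∈ Submodule.span ℂ (S j), Φ (Function.update Y j v) = 0 := by
        intro v hv
        induction hv using Submodule.span_induction with
        | mem x hx =>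
          apply ih
          · intro i hi
            have : i ≠ j := fun e => hj (e ▸ hi)
            rw [Function.update_of_ne this]
            exact h1 i (Finset.mem_insert_of_mem hi)
          · intro i hi
            by_cases e : i = j
            · subst e; simpa using hx
            · rw [Function.update_of_ne e]
              exact h2 i (by simp [e, hi])
        | zero => exact Φ.map_coord_zero j (by simp)
        | add x y _ _ hx hy => rw [Φ.map_update_add, hx, hy, add_zero]
        | smul c x _ hx => rw [Φ.map_update_smul, hx, smul_zero]
      simpa using this (Y j) (h1 j (Finset.mem_insert_self _ _))
  exact key Finset.univ X (fun i _ => hX i) (by simp)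

/-- reversed product as a multilinear map -/
noncomputable def revProd (k : ℕ) (A : Type*) [AddCommGroup A] [Module ℂ A] :
    MultilinearMap ℂ (fun _ : Fin k => Module.End ℂ A) (Module.End ℂ A) :=
  (MultilinearMap.mkPiAlgebraFin ℂ k (Module.End ℂ A)).domDomCongr Fin.revPerm

theorem sEnd_eq {A : Type*} [AddCommGroup A] [Module ℂ A] {k : ℕ}
    (T : Fin k → Module.End ℂ A) :
    sEnd T = MultilinearMap.alternatization (revProd k A) T := by
  rw [MultilinearMap.alternatization_apply]
  unfold sEnd
  refine Finset.sum_congr rfl fun σ _ => ?_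
  rw [Units.smul_def]
  congr 1
  simp only [revProd, MultilinearMap.domDomCongr_apply, MultilinearMap.mkPiAlgebraFin_apply]
  congr 1
  apply List.ext_get
  · simp
  · intro m h1 h2
    simp at h1 h2 ⊢
    congr 2
    apply Fin.ext
    simp
    omega

/-- the alternating functional -/
noncomputable def Phi {n : ℕ} (k : ℕ) (f : MvPolynomial (Fin n) ℂ) :
    (Vect n) [⋀^Fin k]→ₗ[ℂ] ℂ :=
  ((lcoeff ℂ (0 : Fin n →₀ ℕ)).comp (LinearMap.applyₗ f)).compAlternatingMap
    ((MultilinearMap.alternatization (revProd k (MvPolynomial (Fin n) ℂ))).compLinearMap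
      { toFun := fun D : Vect n => D.toLinearMap, map_add' := fun _ _ => rfl,
        map_smul' := fun _ _ => rfl })

theorem Phi_apply {n k : ℕ} (f : MvPolynomial (Fin n) ℂ) (X : Fin k → Vect n) :
    Phi k f X = coeff 0 (sEnd (fun i => (X i).toLinearMap) f) := by
  rw [sEnd_eq]; rfl

/-- monomial fields -/
noncomputable def fld {n : ℕ} (p : (Fin n →₀ ℕ) × Fin n) : Vect n :=
  (monomial p.1 (1 : ℂ)) • pderiv p.2

theorem vect_eq {n : ℕ} (D : Vect n) : D = ∑ a, D (X a) • pderiv a := by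
  apply MvPolynomial.derivation_ext
  intro i
  have : ∀ s : Finset (Fin n), (∑ a ∈ s, D (X a) • (pderiv a : Vect n)) (X i)
      = ∑ a ∈ s, D (X a) * pderiv a (X i) := by
    intro s
    induction s using Finset.induction_on with
    | empty => simp
    | insert a s ha ih =>
      rw [Finset.sum_insert ha, Finset.sum_insert ha, Derivation.add_apply, ih]; rfl
  rw [this]
  simp [pderiv_X, Pi.single_apply]

theorem vect_mem {n : ℕ} (D : Vect n) (T : Set (Fin n →₀ ℕ))
    (h : ∀ i γ, coeff γ (D (X i)) ≠ 0 → γ ∈ T) :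
    D ∈ Submodule.span ℂ (fld '' {p | p.1 ∈ T}) := by
  rw [vect_eq D]
  refine Submodule.sum_mem _ fun a _ => ?_
  rw [(D (X a)).as_sum, Finset.sum_smul]
  refine Submodule.sum_mem _ fun γ hγ => ?_
  have : (monomial γ (coeff γ (D (X a))) : MvPolynomial (Fin n) ℂ) • (pderiv a : Vect n)
      = coeff γ (D (X a)) • fld (γ, a) := by
    unfold fld
    rw [← smul_assoc, smul_monomial]; simp
  rw [this]
  refine Submodule.smul_mem _ _ (Submodule.subset_span ⟨(γ, a), h a γ ?_, rfl⟩)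
  exact mem_support_iff.mp hγ

/-- homogeneity for an additive weight -/
def WH {n : ℕ} (w : (Fin n →₀ ℕ) →+ ℤ) (m : ℤ) (g : MvPolynomial (Fin n) ℂ) : Prop :=
  ∀ γ, coeff γ g ≠ 0 → w γ = m

theorem WH_fld {n : ℕ} (w : (Fin n →₀ ℕ) →+ ℤ) (m : ℤ) (g : MvPolynomial (Fin n) ℂ)
    (p : (Fin n →₀ ℕ) × Fin n) (h : WH w m g) :
    WH w (m + (w p.1 - w (Finsupp.single p.2 1))) (fld p g) := by
  intro γ hγ
  have e : fld p g = monomial p.1 1 * pderiv p.2 g := rfl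
  rw [e, coeff_monomial_mul'] at hγ
  split_ifs at hγ with hle
  · rw [coeff_pderiv] at hγ
    have h1 : coeff (γ - p.1 + Finsupp.single p.2 1) g ≠ 0 := by
      intro h0; rw [h0] at hγ; simp at hγ
    have h2 := h _ h1
    have h3 : w γ = w (γ - p.1) + w p.1 := by
      rw [← map_add, tsub_add_cancel_of_le hle]
    rw [map_add] at h2
    omega
  · exact absurd rfl hγ

theorem WH_prod {n : ℕ} (w : (Fin n →₀ ℕ) →+ ℤ) (g : MvPolynomial (Fin n) ℂ)
    (L : List ((Fin n →₀ ℕ) × Fin n)) (m : ℤ) (h : WH w m g) :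
    WH w (m + (L.map fun p => w p.1 - w (Finsupp.single p.2 1)).sum)
      ((L.map fun p => (fld p).toLinearMap).prod g) := by
  induction L with
  | nil => simpa using h
  | cons p L ih =>
    have := WH_fld w _ _ p ih
    simp only [List.map_cons, List.prod_cons, List.sum_cons]
    convert this using 1
    · ring
    · rfl

theorem Phi_weight {n k : ℕ} (w : (Fin n →₀ ℕ) →+ ℤ) (m : ℤ) (f : MvPolynomial (Fin n) ℂ)
    (hf : WH w m f) (p : Fin k → (Fin n →₀ ℕ) × Fin n)
    (h : m + ∑ i, (w (p i).1 - w (Finsupp.single (p i).2 1)) ≠ 0) :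
    Phi k f (fun i => fld (p i)) = 0 := by
  rw [Phi_apply]
  unfold sEnd
  rw [LinearMap.sum_apply, coeff_sum]
  refine Finset.sum_eq_zero fun σ _ => ?_
  rw [LinearMap.smul_apply, coeff_smul]
  have := WH_prod w f (List.ofFn fun i => p (σ i)).reverse m hf
  rw [List.map_reverse, List.map_reverse, List.map_ofFn, List.map_ofFn, List.sum_reverse,
    List.sum_ofFn] at this
  by_contra h0
  apply h
  have h1 := this 0 (by
    intro h2; apply h0
    rw [show (List.ofFn fun i => (fld (p (σ i))).toLinearMap) = List.ofFn ((fun p => (fld p).toLinearMap) ∘ fun i => p (σ i)) from rfl, h2, smul_zero])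
  rw [map_zero] at h1
  rw [h1]
  congr 1
  exact (Equiv.sum_comp σ (fun i => w (p i).1 - w (Finsupp.single (p i).2 1))).symm

/-- conjugation of a field by an automorphism -/
noncomputable def conjD {n : ℕ} (φ : MvPolynomial (Fin n) ℂ ≃ₐ[ℂ] MvPolynomial (Fin n) ℂ)
    (D : Vect n) : Vect n :=
  Derivation.mk' (φ.toLinearMap ∘ₗ D.toLinearMap ∘ₗ φ.symm.toLinearMap) (by
    intro a b; simp)

theorem conjD_apply {n : ℕ} (φ : MvPolynomial (Fin n) ℂ ≃ₐ[ℂ] MvPolynomial (Fin n) ℂ)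
    (D : Vect n) (f) : conjD φ D f = φ (D (φ.symm f)) := rfl

theorem conj_list {n : ℕ} (φ : MvPolynomial (Fin n) ℂ ≃ₐ[ℂ] MvPolynomial (Fin n) ℂ)
    (L : List (Vect n)) (f) :
    (L.map fun D => (conjD φ D).toLinearMap).prod (φ f)
      = φ ((L.map fun D => D.toLinearMap).prod f) := by
  induction L with
  | nil => simp
  | cons D L ih =>
    simp only [List.map_cons, List.prod_cons, Module.End.mul_apply, ih]
    change conjD φ D _ = _
    rw [conjD_apply, AlgEquiv.symm_apply_apply]; rfl

theorem sEnd_conj {n k : ℕ} (φ : MvPolynomial (Fin n) ℂ ≃ₐ[ℂ] MvPolynomial (Fin n) ℂ)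
    (Y : Fin k → Vect n) (f) :
    sEnd (fun i => (conjD φ (Y i)).toLinearMap) (φ f)
      = φ (sEnd (fun i => (Y i).toLinearMap) f) := by
  unfold sEnd
  rw [LinearMap.sum_apply, LinearMap.sum_apply, map_sum]
  refine Finset.sum_congr rfl fun σ _ => ?_
  rw [LinearMap.smul_apply, LinearMap.smul_apply, map_zsmul]
  have := conj_list φ (List.ofFn fun i => Y (σ i)).reverse f
  rw [List.map_reverse, List.map_reverse, List.map_ofFn, List.map_ofFn] at this
  congr 1

end S0

section S1

/-- coordinate weight -/
noncomputable def wco {n : ℕ} (t : Fin n) : (Fin n →₀ ℕ) →+ ℤ :=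
  (Nat.castAddMonoidHom ℤ).comp (Finsupp.applyAddHom t)

theorem wco_apply {n : ℕ} (t : Fin n) (γ : Fin n →₀ ℕ) : wco t γ = (γ t : ℤ) := rfl

/-- degree weight -/
noncomputable def wdeg {n : ℕ} : (Fin n →₀ ℕ) →+ ℤ :=
  (Nat.castAddMonoidHom ℤ).comp Finsupp.degree

theorem wdeg_apply {n : ℕ} (γ : Fin n →₀ ℕ) : wdeg γ = (γ.degree : ℤ) := rfl

theorem WH_mul {n : ℕ} {w : (Fin n →₀ ℕ) →+ ℤ} {m m' : ℤ} {g g' : MvPolynomial (Fin n) ℂ}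
    (h : WH w m g) (h' : WH w m' g') : WH w (m + m') (g * g') := by
  intro γ hγ
  rw [coeff_mul] at hγ
  obtain ⟨x, hx, hx'⟩ := Finset.exists_ne_zero_of_sum_ne_zero hγ
  rw [← Finset.HasAntidiagonal.mem_antidiagonal.mp hx, map_add, h _ (left_ne_zero_of_mul hx'),
    h' _ (right_ne_zero_of_mul hx')]

theorem WH_C {n : ℕ} (w : (Fin n →₀ ℕ) →+ ℤ) (c : ℂ) :
    WH w 0 (C c : MvPolynomial (Fin n) ℂ) := by
  intro γ hγ
  rw [coeff_C] at hγ
  split_ifs at hγ with h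
  · rw [← h, map_zero]
  · exact absurd rfl hγ

theorem WH_monomial {n : ℕ} (w : (Fin n →₀ ℕ) →+ ℤ) (β : Fin n →₀ ℕ) (c : ℂ) :
    WH w (w β) (monomial β c) := by
  intro γ hγ
  rw [coeff_monomial] at hγ
  split_ifs at hγ with h
  · rw [h]
  · exact absurd rfl hγ

/-- linear forms -/
noncomputable def lin {n : ℕ} (v : Fin n → ℂ) : MvPolynomial (Fin n) ℂ := ∑ i, C (v i) * X i

theorem WH_lin {n : ℕ} (w : (Fin n →₀ ℕ) →+ ℤ) (m : ℤ) (v : Fin n → ℂ)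
    (h : ∀ i, v i ≠ 0 → w (Finsupp.single i 1) = m) : WH w m (lin v) := by
  intro γ hγ
  unfold lin at hγ
  rw [coeff_sum] at hγ
  obtain ⟨i, -, hi⟩ := Finset.exists_ne_zero_of_sum_ne_zero hγ
  rw [coeff_C_mul, coeff_X] at hi
  split_ifs at hi with h0
  · rw [← h0]; exact h i (left_ne_zero_of_mul hi)
  · simp at hi

theorem Phi_not_inj {n k : ℕ} (f : MvPolynomial (Fin n) ℂ) (p : Fin k → (Fin n →₀ ℕ) × Fin n)
    (h : ¬ Function.Injective p) : Phi k f (fun i => fld (p i)) = 0 := by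
  apply AlternatingMap.map_eq_zero_of_not_injective
  intro h'
  exact h (Function.Injective.of_comp (f := fld) h')

theorem deg_one {n : ℕ} {γ : Fin n →₀ ℕ} (h : γ.degree = 1) : ∃ b, γ = Finsupp.single b 1 := by
  have : γ ∈ {d : Fin n →₀ ℕ | d.degree = 1} := h
  rw [← Finsupp.range_single_one] at this
  obtain ⟨b, hb⟩ := this
  exact ⟨b, hb.symm⟩

theorem deg_two {n : ℕ} {γ : Fin n →₀ ℕ} (h : γ.degree = 2) :
    ∃ b c, γ = Finsupp.single b 1 + Finsupp.single c 1 := by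
  obtain ⟨δ, h1, h2⟩ := Finsupp.exists_le_degree_eq γ 1 (by omega)
  obtain ⟨b, rfl⟩ := deg_one h2
  have h3 : (γ - Finsupp.single b 1) + Finsupp.single b 1 = γ := tsub_add_cancel_of_le h1
  have h4 : (γ - Finsupp.single b 1).degree = 1 := by
    have := congrArg Finsupp.degree h3
    rw [map_add, h2, h] at this
    omega
  obtain ⟨c, hc⟩ := deg_one h4
  exact ⟨c, b, by rw [← h3, hc]⟩

/-- the finite set of linear monomial fields -/
noncomputable def linSet (n : ℕ) : Finset ((Fin n →₀ ℕ) × Fin n) :=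
  Finset.univ.image (fun q : Fin n × Fin n => (Finsupp.single q.1 1, q.2))

theorem linSet_card (n : ℕ) : (linSet n).card ≤ n ^ 2 := by
  refine Finset.card_image_le.trans ?_
  simp [sq]

theorem mem_linSet {n : ℕ} {q : (Fin n →₀ ℕ) × Fin n} (h : q.1.degree = 1) : q ∈ linSet n := by
  obtain ⟨b, hb⟩ := deg_one h
  exact Finset.mem_image.mpr ⟨(b, q.2), Finset.mem_univ _, by ext1 <;> simp [hb]⟩

/-- Lemma K on monomial fields -/
theorem lemK_mon {n k : ℕ} (t : Fin n) (p : Fin k → (Fin n →₀ ℕ) × Fin n)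
    (hP : (Finset.univ.filter fun i => (p i).1.degree = 0).card = n)
    (hQ : (Finset.univ.filter fun i => (p i).1.degree = 1).card = n ^ 2)
    (hR : ∀ i, 2 ≤ (p i).1.degree → (p i).1 t = 0)
    (f : MvPolynomial (Fin n) ℂ) (hf : WH (wco t) 0 f) :
    Phi k f (fun i => fld (p i)) = 0 := by
  by_cases hinj : Function.Injective p
  swap
  · exact Phi_not_inj f p hinj
  apply Phi_weight (wco t) 0 f hf
  set g : (Fin n →₀ ℕ) × Fin n → ℤ := fun q => wco t q.1 - wco t (Finsupp.single q.2 1) with hg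
  change 0 + ∑ i, g (p i) ≠ 0
  rw [← Finset.sum_filter_add_sum_filter_not Finset.univ (fun i => (p i).1.degree = 0),
    ← Finset.sum_filter_add_sum_filter_not (Finset.univ.filter fun i => ¬ (p i).1.degree = 0)
      (fun i => (p i).1.degree = 1)]
  have e1 : ∑ i ∈ Finset.univ.filter (fun i => (p i).1.degree = 0), g (p i) = -1 := by
    have i1 : Set.InjOn (fun i => (p i).2)
        (Finset.univ.filter fun i => (p i).1.degree = 0 : Finset (Fin k)) := by
      intro i hi j hj hij
      simp only [Finset.coe_filter, Finset.mem_univ, true_and, Set.mem_ofPred_eq,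
        Finsupp.degree_eq_zero_iff] at hi hj
      exact hinj (Prod.ext (by rw [hi, hj]) hij)
    have i2 : (Finset.univ.filter fun i => (p i).1.degree = 0).image (fun i => (p i).2)
        = Finset.univ := by
      apply Finset.eq_univ_of_card
      rw [Finset.card_image_of_injOn i1, hP, Fintype.card_fin]
    calc _ = ∑ i ∈ Finset.univ.filter (fun i => (p i).1.degree = 0), g (0, (p i).2) := by
            refine Finset.sum_congr rfl fun i hi => ?_
            have := (Finsupp.degree_eq_zero_iff _).mp (Finset.mem_filter.mp hi).2
            rw [← this]
      _ = ∑ a ∈ Finset.univ, g (0, a) := by rw [← i2, Finset.sum_image i1]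
      _ = -1 := by
        simp [hg, wco_apply, Finsupp.single_apply]
  have e2 : ∑ i ∈ (Finset.univ.filter fun i => ¬ (p i).1.degree = 0).filter
      (fun i => (p i).1.degree = 1), g (p i) = 0 := by
    have h0 : (Finset.univ.filter fun i => ¬ (p i).1.degree = 0).filter
      (fun i => (p i).1.degree = 1) = Finset.univ.filter (fun i => (p i).1.degree = 1) := by
      ext i; simp; omega
    rw [h0]
    have i2 : (Finset.univ.filter fun i => (p i).1.degree = 1).image p = linSet n := by
      apply Finset.eq_of_subset_of_card_le
      · intro q hq
        obtain ⟨i, hi, rfl⟩ := Finset.mem_image.mp hq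
        exact mem_linSet (Finset.mem_filter.mp hi).2
      · rw [Finset.card_image_of_injective _ hinj, hQ]; exact linSet_card n
    rw [← Finset.sum_image (f := g) (g := p) (fun _ _ _ _ h => hinj h), i2, linSet,
      Finset.sum_image]
    · rw [Fintype.sum_prod_type]
      simp [hg, wco_apply, Finsupp.single_apply]
    · rintro ⟨a, b⟩ - ⟨c, d⟩ - h
      simp only [Prod.mk.injEq] at h
      have := Finsupp.single_left_injective (one_ne_zero) h.1
      simp_all
  have e3 : ∑ i ∈ (Finset.univ.filter fun i => ¬ (p i).1.degree = 0).filter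
      (fun i => ¬ (p i).1.degree = 1), g (p i) ≤ 0 := by
    refine Finset.sum_nonpos fun i hi => ?_
    simp only [Finset.mem_filter, Finset.mem_univ, true_and] at hi
    have := hR i (by omega)
    simp only [hg, wco_apply, this]
    simp
  rw [e1, e2]
  omega

theorem lemK {n k : ℕ} (t : Fin n) (d : Fin k → ℕ)
    (hP : (Finset.univ.filter fun i => d i = 0).card = n)
    (hQ : (Finset.univ.filter fun i => d i = 1).card = n ^ 2)
    (Y : Fin k → Vect n) (hY : ∀ i j, WH wdeg (d i) (Y i (X j)))
    (hR : ∀ i j, 2 ≤ d i → WH (wco t) 0 (Y i (X j)))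
    (f : MvPolynomial (Fin n) ℂ) (hf : WH (wco t) 0 f) :
    Phi k f Y = 0 := by
  refine multilin_span (Phi k f).toMultilinearMap
    (fun i => fld '' {p | p.1 ∈ {γ : Fin n →₀ ℕ | γ.degree = d i ∧ (2 ≤ d i → γ t = 0)}}) ?_ Y ?_
  · intro Z hZ
    choose p hp hpZ using hZ
    have : Z = fun i => fld (p i) := funext fun i => (hpZ i).symm
    subst this
    have hd : ∀ i, (p i).1.degree = d i := fun i => (hp i).1
    refine lemK_mon t p ?_ ?_ ?_ f hf
    · simpa only [hd] using hP
    · simpa only [hd] using hQ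
    · intro i hi; exact (hp i).2 (by rw [← hd]; exact hi)
  · intro i
    apply vect_mem
    intro j γ hγ
    refine ⟨?_, fun h2 => ?_⟩
    · have := hY i j γ hγ
      rw [wdeg_apply] at this; exact_mod_cast this
    · have := hR i j h2 γ hγ
      rw [wco_apply] at this; exact_mod_cast this

theorem exists_dir {n : ℕ} {ι : Type} [Fintype ι] (h : Fintype.card ι < n) (v : ι → Fin n → ℂ) :
    ∃ (t : Fin n) (c : Fin n → ℂ), c t = 1 ∧ ∀ j, ∑ i, v j i * c i = 0 := by
  have h1 : LinearMap.ker (Matrix.mulVecLin (Matrix.of v)) ≠ ⊥ :=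
    LinearMap.ker_ne_bot_of_finrank_lt (by simpa using h)
  obtain ⟨x, hx, hx0⟩ := Submodule.exists_mem_ne_zero_of_ne_bot h1
  obtain ⟨t, ht⟩ := Function.ne_iff.mp hx0
  refine ⟨t, fun i => x i / x t, div_self ht, fun j => ?_⟩
  have := congrFun (LinearMap.mem_ker.mp hx) j
  simp only [Matrix.mulVecLin_apply, Matrix.mulVec, dotProduct, Matrix.of_apply, Pi.zero_apply] at this
  simp_rw [← mul_div_assoc, ← Finset.sum_div, this, zero_div]

/-- the transvection-type automorphism `x_i ↦ x_i + e_i x_t` -/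
noncomputable def tv {n : ℕ} (t : Fin n) (e : Fin n → ℂ) (he : e t = 0) :
    MvPolynomial (Fin n) ℂ ≃ₐ[ℂ] MvPolynomial (Fin n) ℂ :=
  AlgEquiv.ofAlgHom (aeval fun i => X i + C (e i) * X t) (aeval fun i => X i - C (e i) * X t)
    (by ext i : 1; simp [he, algebraMap_eq]) (by ext i : 1; simp [he, algebraMap_eq])

theorem tv_X {n : ℕ} (t : Fin n) (e : Fin n → ℂ) (he : e t = 0) (i : Fin n) :
    tv t e he (X i) = X i + C (e i) * X t := by simp [tv]

theorem tv_symm_X {n : ℕ} (t : Fin n) (e : Fin n → ℂ) (he : e t = 0) (i : Fin n) :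
    (tv t e he).symm (X i) = X i - C (e i) * X t := by simp [tv]

theorem tv_C {n : ℕ} (t : Fin n) (e : Fin n → ℂ) (he : e t = 0) (c : ℂ) :
    tv t e he (C c) = C c := (tv t e he).commutes c

theorem lin_eq {n : ℕ} (t : Fin n) (e : Fin n → ℂ) (he : e t = 0) (v : Fin n → ℂ) :
    tv t e he (lin v) = lin (v + Pi.single t (∑ i, v i * e i)) := by
  unfold lin
  rw [map_sum]
  simp only [map_mul, tv_C, tv_X, Pi.add_apply, C_add, mul_add, add_mul,
    Finset.sum_add_distrib]
  congr 1
  symm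
  rw [Finset.sum_eq_single t]
  · rw [Pi.single_eq_same, map_sum, Finset.sum_mul]
    refine Finset.sum_congr rfl fun i _ => ?_
    rw [C_mul]; ring
  · intro b _ hb; simp [hb]
  · simp

theorem conj_val {n : ℕ} (t : Fin n) (e : Fin n → ℂ) (he : e t = 0) (g) (a j : Fin n) :
    ∃ r : ℂ, conjD (tv t e he) (g • (pderiv a : Vect n)) (X j) = tv t e he g * C r := by
  refine ⟨(Pi.single a (1 : ℂ) : Fin n → ℂ) j - e j * (Pi.single a (1 : ℂ) : Fin n → ℂ) t, ?_⟩
  rw [conjD_apply, tv_symm_X, Derivation.smul_apply, smul_eq_mul, map_mul]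
  congr 1
  rw [map_sub, pderiv_C_mul, pderiv_X, pderiv_X]
  refine Eq.trans (congrArg (tv t e he) ?_) (tv_C t e he _)
  rw [C_sub, C_mul]
  have : ∀ j, (Pi.single a (1 : MvPolynomial (Fin n) ℂ) : Fin n → _) j
      = C ((Pi.single a (1 : ℂ) : Fin n → ℂ) j) := by
    intro j
    by_cases h : j = a
    · subst h; simp
    · simp [h]
  rw [this, this]

theorem coeff_zero_tv {n : ℕ} (t : Fin n) (e : Fin n → ℂ) (he : e t = 0) (f) :
    coeff 0 (tv t e he f) = coeff 0 f := by
  change constantCoeff (tv t e he f) = constantCoeff f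
  have : (constantCoeff (σ := Fin n) (R := ℂ)).comp (tv t e he : MvPolynomial (Fin n) ℂ →+* MvPolynomial (Fin n) ℂ) = constantCoeff := by
    apply MvPolynomial.ringHom_ext
    · intro r; simp [tv_C]
    · intro i; simp [tv_X]
  exact congrArg (fun q => q f) this

end S1

section S2

theorem WH_add {n : ℕ} {w : (Fin n →₀ ℕ) →+ ℤ} {m : ℤ} {g g' : MvPolynomial (Fin n) ℂ}
    (h : WH w m g) (h' : WH w m g') : WH w m (g + g') := by
  intro γ hγ
  rw [coeff_add] at hγ
  by_cases h0 : coeff γ g = 0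
  · exact h' γ (by intro h1; apply hγ; rw [h0, h1, add_zero])
  · exact h γ h0

theorem critA {n k : ℕ} (p : Fin k → (Fin n →₀ ℕ) × Fin n)
    (hd : ∀ i, (p i).1.degree ≤ 2)
    (hP : (Finset.univ.filter fun i => (p i).1.degree = 0).card = n)
    (hQ : (Finset.univ.filter fun i => (p i).1.degree = 1).card = n ^ 2)
    (hR : (Finset.univ.filter fun i => (p i).1.degree = 2).card + 1 < n)
    (v : Fin k → Fin n → ℂ) (a : Fin k → Fin n) (u : Fin n → ℂ) (Y : Fin k → Vect n)
    (hY2 : ∀ i, (p i).1.degree = 2 → Y i = (lin (v i) * lin (v i)) • pderiv (a i))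
    (hY : ∀ i, (p i).1.degree ≠ 2 → Y i = fld (p i)) :
    Phi k (lin u * lin u) Y = 0 := by
  obtain ⟨t, c, hct, hc⟩ := exists_dir (ι := Option {i // (p i).1.degree = 2})
    (by rw [Fintype.card_option, Fintype.card_subtype]; exact hR)
    (fun o => o.elim u (fun i => v i.1))
  have hu : ∑ i, u i * c i = 0 := hc none
  have hv : ∀ i, (p i).1.degree = 2 → ∑ j, v i j * c j = 0 := fun i hi => hc (some ⟨i, hi⟩)
  have he : (Function.update c t 0) t = 0 := by simp
  have key : ∀ x : Fin n → ℂ, ∑ i, x i * c i = 0 →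
      WH (wco t) 0 (tv t _ he (lin x)) ∧ WH wdeg 1 (tv t _ he (lin x)) := by
    intro x hx
    have h1 : ∑ i, x i * (Function.update c t 0) i = - x t := by
      rw [← Finset.add_sum_erase _ _ (Finset.mem_univ t)] at hx ⊢
      rw [hct] at hx
      have : ∑ i ∈ Finset.univ.erase t, x i * (Function.update c t 0) i
          = ∑ i ∈ Finset.univ.erase t, x i * c i := by
        refine Finset.sum_congr rfl fun i hi => ?_
        rw [Function.update_of_ne (Finset.ne_of_mem_erase hi)]
      rw [this, he]
      linear_combination hx
    rw [lin_eq, h1]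
    constructor
    · apply WH_lin
      intro i hi
      have : i ≠ t := by rintro rfl; simp at hi
      simp [wco_apply, this.symm]
    · apply WH_lin
      intro i _
      simp [wdeg_apply]
  have : Phi k (lin u * lin u) Y
      = Phi k (tv t _ he (lin u * lin u)) (fun i => conjD (tv t _ he) (Y i)) := by
    rw [Phi_apply, Phi_apply, sEnd_conj, coeff_zero_tv]
  rw [this]
  apply lemK t (fun i => (p i).1.degree) hP hQ
  · intro i j
    by_cases h2 : (p i).1.degree = 2
    · rw [hY2 i h2]
      obtain ⟨r, hr⟩ := conj_val t _ he (lin (v i) * lin (v i)) (a i) j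
      rw [hr, map_mul]
      have := WH_mul (WH_mul (key _ (hv i h2)).2 (key _ (hv i h2)).2) (WH_C wdeg r)
      rw [h2]; exact this
    · rw [hY i h2]
      obtain ⟨r, hr⟩ := conj_val t _ he (monomial (p i).1 1) (p i).2 j
      unfold fld
      rw [hr]
      have h3 : WH wdeg ((p i).1.degree : ℕ) (tv t _ he (monomial (p i).1 1)) := by
        have h01 : (p i).1.degree = 0 ∨ (p i).1.degree = 1 := by have := hd i; omega
        rcases h01 with h | h
        · rw [h, (Finsupp.degree_eq_zero_iff _).mp h]
          have : (monomial (0 : Fin n →₀ ℕ) (1 : ℂ)) = C 1 := rfl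
          rw [this, tv_C]
          exact WH_C _ _
        · obtain ⟨b, hb⟩ := deg_one h
          rw [h, hb]
          change WH wdeg _ (tv t _ he (X b))
          rw [tv_X]
          have hX : ∀ b : Fin n, WH wdeg 1 (X b : MvPolynomial (Fin n) ℂ) := by
            intro b
            have := WH_monomial wdeg (Finsupp.single b 1) (1 : ℂ)
            rw [wdeg_apply, Finsupp.degree_single] at this
            exact this
          refine WH_add (hX b) ?_
          have := WH_mul (WH_C wdeg ((Function.update c t 0) b)) (hX t)
          rw [zero_add] at this
          exact this
      have := WH_mul h3 (WH_C wdeg r)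
      rw [add_zero] at this
      exact this
  · intro i j h2
    have h2' : (p i).1.degree = 2 := le_antisymm (hd i) h2
    rw [hY2 i h2']
    obtain ⟨r, hr⟩ := conj_val t _ he (lin (v i) * lin (v i)) (a i) j
    rw [hr, map_mul]
    exact WH_mul (WH_mul (key _ (hv i h2')).1 (key _ (hv i h2')).1) (WH_C (wco t) r)
  · rw [map_mul]
    exact WH_mul (key _ hu).1 (key _ hu).1

theorem lin_single {n : ℕ} (b : Fin n) : lin (Pi.single b 1) = X b := by
  unfold lin
  rw [Finset.sum_eq_single b]
  · simp
  · intro c _ hc; simp [hc]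
  · simp

theorem lin_add {n : ℕ} (u v : Fin n → ℂ) : lin (u + v) = lin u + lin v := by
  simp [lin, add_mul, Finset.sum_add_distrib]

theorem polar {n : ℕ} {γ : Fin n →₀ ℕ} (h : γ.degree = 2) :
    (monomial γ (1 : ℂ)) ∈ Submodule.span ℂ (Set.range fun u : Fin n → ℂ => lin u * lin u) := by
  obtain ⟨b, c, rfl⟩ := deg_two h
  have e : (monomial (Finsupp.single b 1 + Finsupp.single c 1) (1 : ℂ))
      = (1 / 2 : ℂ) • ((lin (Pi.single b 1 + Pi.single c 1) * lin (Pi.single b 1 + Pi.single c 1)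
        - lin (Pi.single b 1) * lin (Pi.single b 1)) - lin (Pi.single c 1) * lin (Pi.single c 1)) := by
    have h1 : (monomial (Finsupp.single b 1 + Finsupp.single c 1) (1 : ℂ))
        = (X b * X c : MvPolynomial (Fin n) ℂ) := by
      simp [X, monomial_mul]
    rw [h1, lin_add, lin_single, lin_single]
    have h2 : (X b * X c : MvPolynomial (Fin n) ℂ) = (1 / 2 : ℂ) • ((2 : ℂ) • (X b * X c)) := by
      rw [smul_smul]; norm_num
    rw [h2]
    congr 1
    rw [ofNat_smul_eq_nsmul, nsmul_eq_mul]
    push_cast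
    ring
  rw [e]
  refine Submodule.smul_mem _ _ (Submodule.sub_mem _ (Submodule.sub_mem _ ?_ ?_) ?_) <;>
    exact Submodule.subset_span ⟨_, rfl⟩

theorem Phi_lin {n k : ℕ} (Y : Fin k → Vect n) (f) (S : Set (MvPolynomial (Fin n) ℂ))
    (hf : f ∈ Submodule.span ℂ S) (h : ∀ g ∈ S, Phi k g Y = 0) : Phi k f Y = 0 := by
  induction hf using Submodule.span_induction with
  | mem x hx => exact h x hx
  | zero => rw [Phi_apply]; simp
  | add x y _ _ hx hy =>
    rw [Phi_apply] at *; rw [map_add, coeff_add, hx, hy, add_zero]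
  | smul c x _ hx =>
    rw [Phi_apply] at *; rw [map_smul, coeff_smul, hx, smul_zero]

theorem crit {n k : ℕ} (p : Fin k → (Fin n →₀ ℕ) × Fin n) (β : Fin n →₀ ℕ)
    (hd : ∀ i, (p i).1.degree ≤ 2)
    (hP : (Finset.univ.filter fun i => (p i).1.degree = 0).card = n)
    (hQ : (Finset.univ.filter fun i => (p i).1.degree = 1).card = n ^ 2)
    (hR : (Finset.univ.filter fun i => (p i).1.degree = 2).card + 1 < n)
    (hβ : β.degree = 2) :
    Phi k (monomial β 1) (fun i => fld (p i)) = 0 := by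
  apply Phi_lin _ _ _ (polar hβ)
  rintro _ ⟨u, rfl⟩
  refine multilin_span (Phi k (lin u * lin u)).toMultilinearMap
    (fun i => {D | ∃ v : Fin n → ℂ, ((p i).1.degree = 2 → D = (lin v * lin v) • pderiv (p i).2) ∧
      ((p i).1.degree ≠ 2 → D = fld (p i))}) ?_ _ ?_
  · intro Y hY
    choose v hv1 hv2 using hY
    exact critA p hd hP hQ hR v (fun i => (p i).2) u Y hv1 hv2
  · intro i
    by_cases h2 : (p i).1.degree = 2
    · have : ∀ g ∈ Submodule.span ℂ (Set.range fun u : Fin n → ℂ => lin u * lin u),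
          g • (pderiv (p i).2 : Vect n) ∈ Submodule.span ℂ {D : Vect n | ∃ v : Fin n → ℂ,
            ((p i).1.degree = 2 → D = (lin v * lin v) • pderiv (p i).2) ∧
            ((p i).1.degree ≠ 2 → D = fld (p i))} := by
        intro g hg
        induction hg using Submodule.span_induction with
        | mem x hx =>
          obtain ⟨v, rfl⟩ := hx
          exact Submodule.subset_span ⟨v, fun _ => rfl, fun h => absurd h2 h⟩
        | zero => rw [zero_smul]; exact Submodule.zero_mem _
        | add x y _ _ hx hy => rw [add_smul]; exact Submodule.add_mem _ hx hy
        | smul c x _ hx => rw [smul_assoc]; exact Submodule.smul_mem _ _ hx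
      exact this _ (polar h2)
    · exact Submodule.subset_span ⟨0, fun h => absurd h h2, fun _ => rfl⟩

theorem claim_mon {n k : ℕ} (hn : 1 ≤ n) (hk : n ^ 2 + 2 * n - 2 ≤ k)
    (p : Fin k → (Fin n →₀ ℕ) × Fin n) (β : Fin n →₀ ℕ) (hβ : 2 ≤ β.degree) :
    Phi k (monomial β 1) (fun i => fld (p i)) = 0 := by
  by_cases hinj : Function.Injective p
  swap
  · exact Phi_not_inj _ p hinj
  by_cases hw : wdeg β + ∑ i, (wdeg (p i).1 - wdeg (Finsupp.single (p i).2 1)) = 0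
  swap
  · exact Phi_weight wdeg _ _ (WH_monomial wdeg β 1) p hw
  simp only [wdeg_apply, Finsupp.degree_single] at hw
  have hP : (Finset.univ.filter fun i => (p i).1.degree = 0).card ≤ n := by
    have i1 : Set.InjOn (fun i => (p i).2)
        (Finset.univ.filter fun i => (p i).1.degree = 0 : Finset (Fin k)) := by
      intro i hi j hj hij
      simp only [Finset.coe_filter, Finset.mem_univ, true_and, Set.mem_ofPred_eq,
        Finsupp.degree_eq_zero_iff] at hi hj
      exact hinj (Prod.ext (by rw [hi, hj]) hij)
    rw [← Finset.card_image_of_injOn i1]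
    exact (Finset.card_le_univ _).trans (by simp)
  have hQ : (Finset.univ.filter fun i => (p i).1.degree = 1).card ≤ n ^ 2 := by
    rw [← Finset.card_image_of_injective _ hinj]
    refine (Finset.card_le_card ?_).trans (linSet_card n)
    intro q hq
    obtain ⟨i, hi, rfl⟩ := Finset.mem_image.mp hq
    exact mem_linSet (Finset.mem_filter.mp hi).2
  -- `deg - 1 = 1 - 2[deg=0] - [deg=1] + (deg - 2)⁺`
  have hsum : ∑ i, (((p i).1.degree : ℤ) - ((1 : ℕ) : ℤ))
      = k - 2 * (Finset.univ.filter fun i => (p i).1.degree = 0).card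
        - (Finset.univ.filter fun i => (p i).1.degree = 1).card
        + ∑ i, (((p i).1.degree - 2 : ℕ) : ℤ) := by
    have h1 : ∀ i, (((p i).1.degree : ℤ) - ((1 : ℕ) : ℤ))
        = 1 - 2 * (if (p i).1.degree = 0 then (1 : ℤ) else 0)
          - (if (p i).1.degree = 1 then (1 : ℤ) else 0) + (((p i).1.degree - 2 : ℕ) : ℤ) := by
      intro i; split_ifs <;> omega
    rw [Finset.sum_congr rfl fun i _ => h1 i]
    rw [Finset.sum_add_distrib, Finset.sum_sub_distrib, Finset.sum_sub_distrib,
      ← Finset.mul_sum]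
    simp
  have hex : 0 ≤ ∑ i, (((p i).1.degree - 2 : ℕ) : ℤ) := Finset.sum_nonneg fun i _ => by positivity
  have hex0 : ∑ i, (((p i).1.degree - 2 : ℕ) : ℤ) = 0 := by omega
  have hd : ∀ i, (p i).1.degree ≤ 2 := by
    intro i
    have := (Finset.sum_eq_zero_iff_of_nonneg (fun i _ => by positivity)).mp hex0 i
      (Finset.mem_univ i)
    omega
  have hcard : (Finset.univ.filter fun i => (p i).1.degree = 0).card
      + (Finset.univ.filter fun i => (p i).1.degree = 1).card
      + (Finset.univ.filter fun i => (p i).1.degree = 2).card = k := by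
    rw [Finset.card_filter, Finset.card_filter, Finset.card_filter, ← Finset.sum_add_distrib,
      ← Finset.sum_add_distrib]
    trans ∑ i : Fin k, 1
    · refine Finset.sum_congr rfl fun i _ => ?_
      have := hd i
      split_ifs <;> omega
    · simp
  have hnn : n ≤ n ^ 2 := by nlinarith
  apply crit p β hd <;> omega

theorem claim {n k : ℕ} (hn : 1 ≤ n) (hk : n ^ 2 + 2 * n - 2 ≤ k)
    (Y : Fin k → Vect n) (β : Fin n →₀ ℕ) (hβ : 2 ≤ β.degree) :
    Phi k (monomial β 1) Y = 0 := by
  refine multilin_span (Phi k (monomial β 1)).toMultilinearMap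
    (fun i => fld '' {p | p.1 ∈ (Set.univ : Set (Fin n →₀ ℕ))}) ?_ Y ?_
  · intro Z hZ
    choose p hp hpZ using hZ
    have : Z = fun i => fld (p i) := funext fun i => (hpZ i).symm
    subst this
    exact claim_mon hn hk p β hβ
  · intro i
    exact vect_mem _ _ (fun _ _ _ => trivial)

theorem list_one {n : ℕ} (L : List (Vect n)) (hL : L ≠ []) :
    (L.map fun D => D.toLinearMap).prod 1 = 0 := by
  induction L with
  | nil => exact absurd rfl hL
  | cons D L ih =>
    simp only [List.map_cons, List.prod_cons, Module.End.mul_apply]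
    by_cases h : L = []
    · subst h; exact D.map_one_eq_zero
    · rw [ih h]; exact map_zero _

theorem sEnd_one {n k : ℕ} (hk : 1 ≤ k) (Y : Fin k → Vect n) :
    sEnd (fun i => (Y i).toLinearMap) 1 = 0 := by
  unfold sEnd
  rw [LinearMap.sum_apply]
  refine Finset.sum_eq_zero fun σ _ => ?_
  have := list_one (List.ofFn fun i => Y (σ i)).reverse (by
    intro h
    have := congrArg List.length h
    simp at this; omega)
  rw [List.map_reverse, List.map_ofFn] at this
  rw [LinearMap.smul_apply]
  erw [this]
  rw [smul_zero]

theorem sEnd_C {n k : ℕ} (hk : 1 ≤ k) (Y : Fin k → Vect n) (c : ℂ) :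
    sEnd (fun i => (Y i).toLinearMap) (C c) = 0 := by
  have : (C c : MvPolynomial (Fin n) ℂ) = c • 1 := by rw [smul_eq_C_mul, mul_one]
  rw [this, map_smul, sEnd_one hk, smul_zero]

theorem foldl_X {n : ℕ} (L : List (Vect n)) (D : Vect n) (i : Fin n) :
    (L.foldl rsym D) (X i) = (L.map fun D => D.toLinearMap).reverse.prod (D (X i)) := by
  induction L generalizing D with
  | nil => simp
  | cons E L ih =>
    rw [List.foldl_cons, ih]
    simp only [List.map_cons, List.reverse_cons, List.prod_append, List.prod_singleton,
      Module.End.mul_apply]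
    congr 1
    exact mkDerivation_X _ _ _

theorem leftNorm_X {n : ℕ} (L : List (Vect n)) (hL : L ≠ []) (i : Fin n) :
    leftNormProd L (X i) = (L.map fun D => D.toLinearMap).reverse.prod (X i) := by
  cases L with
  | nil => exact absurd rfl hL
  | cons D L =>
    simp only [leftNormProd, foldl_X, List.map_cons, List.reverse_cons, List.prod_append,
      List.prod_singleton, Module.End.mul_apply]
    rfl

theorem sEnd_X {n k : ℕ} (hk : 1 ≤ k) (Y : Fin k → Vect n) (i : Fin n) :
    sEnd (fun i => (Y i).toLinearMap) (X i) = sRsym Y (X i) := by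
  unfold sEnd sRsym
  have : ∀ s : Finset (Equiv.Perm (Fin k)), (∑ σ ∈ s, (Equiv.Perm.sign σ : ℤ) •
      leftNormProd (List.ofFn fun i : Fin k => Y (σ i))) (X i) = ∑ σ ∈ s,
      (Equiv.Perm.sign σ : ℤ) • (leftNormProd (List.ofFn fun i : Fin k => Y (σ i)) (X i)) := by
    intro s
    induction s using Finset.induction_on with
    | empty => simp
    | insert a s ha ih =>
      rw [Finset.sum_insert ha, Finset.sum_insert ha, Derivation.add_apply, ih]; rfl
  rw [this, LinearMap.sum_apply]
  refine Finset.sum_congr rfl fun σ _ => ?_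
  rw [leftNorm_X _ (by
    intro h
    have := congrArg List.length h
    simp at this; omega), List.map_ofFn]
  rfl

theorem main0 {n k : ℕ} (hn : 1 ≤ n) (hk : n ^ 2 + 2 * n - 2 ≤ k)
    (Y : Fin k → Vect n) (D : Vect n)
    (h : ∀ i, sEnd (fun i => (Y i).toLinearMap) (X i) = D (X i)) (f : MvPolynomial (Fin n) ℂ) :
    coeff 0 (sEnd (fun i => (Y i).toLinearMap) f) = coeff 0 (D f) := by
  have hk1 : 1 ≤ k := by nlinarith [Nat.sub_le_iff_le_add.mp hk]
  have hm : ∀ β : Fin n →₀ ℕ, coeff 0 (sEnd (fun i => (Y i).toLinearMap) (monomial β 1))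
      = coeff 0 (D (monomial β 1)) := by
    intro β
    by_cases h0 : β.degree = 0
    · rw [(Finsupp.degree_eq_zero_iff _).mp h0]
      change coeff 0 (sEnd _ (1 : MvPolynomial (Fin n) ℂ)) = coeff 0 (D 1)
      rw [sEnd_one hk1, D.map_one_eq_zero]
    by_cases h1 : β.degree = 1
    · obtain ⟨b, rfl⟩ := deg_one h1
      exact congrArg _ (h b)
    have h2 : 2 ≤ β.degree := by omega
    have := claim hn hk Y β h2
    rw [Phi_apply] at this
    rw [this]
    have hD := vect_eq D
    obtain ⟨δ, h3, h4⟩ := Finsupp.exists_le_degree_eq β 1 (by omega)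
    have h5 : (β - δ) + δ = β := tsub_add_cancel_of_le h3
    have h6 : β - δ ≠ 0 := by
      intro e; rw [e, zero_add] at h5; rw [← h5] at h2; omega
    have h7 : δ ≠ 0 := by
      rintro rfl; simp at h4
    have h8 : (monomial β (1 : ℂ)) = monomial (β - δ) 1 * monomial δ 1 := by
      rw [monomial_mul, h5, one_mul]
    rw [h8, D.leibniz]
    simp only [← constantCoeff_eq, smul_eq_mul, map_add, map_mul]
    simp [constantCoeff_monomial, h6, h7]
  have hf := f.as_sum
  have hmon : ∀ γ, (monomial γ (coeff γ f)) = coeff γ f • (monomial γ (1 : ℂ)) := by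
    intro γ; rw [smul_monomial]; simp
  rw [hf, map_sum, map_sum, coeff_sum, coeff_sum]
  refine Finset.sum_congr rfl fun γ _ => ?_
  rw [hmon, map_smul, Derivation.map_smul, coeff_smul, coeff_smul, hm]

/-- translation -/
noncomputable def trl {n : ℕ} (e : Fin n → ℂ) :
    MvPolynomial (Fin n) ℂ ≃ₐ[ℂ] MvPolynomial (Fin n) ℂ :=
  AlgEquiv.ofAlgHom (aeval fun i => X i + C (e i)) (aeval fun i => X i - C (e i))
    (by ext i : 1; simp [algebraMap_eq]) (by ext i : 1; simp [algebraMap_eq])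

theorem trl_symm_X {n : ℕ} (e : Fin n → ℂ) (i : Fin n) :
    (trl e).symm (X i) = X i - C (e i) := by simp [trl]

theorem coeff_zero_trl {n : ℕ} (e : Fin n → ℂ) (f) :
    coeff 0 (trl e f) = eval e f := by
  change constantCoeff (trl e f) = eval e f
  have : (constantCoeff (σ := Fin n) (R := ℂ)).comp (trl e : MvPolynomial (Fin n) ℂ →+* MvPolynomial (Fin n) ℂ) = eval e := by
    apply MvPolynomial.ringHom_ext
    · intro r; simp [trl, algebraMap_eq]
    · intro i; simp [trl]
  exact congrArg (fun q => q f) this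

end S2

/-- for `k ≥ n² + 2n − 2`, `s_k = s_k^{rsym}` on `Vect(n)`;
in particular `s_k` is a well-defined `k`-ary operation on vector fields. -/
theorem stmt_0 (n k : ℕ) (hn : 1 ≤ n) (hk : n ^ 2 + 2 * n - 2 ≤ k)
    (X : Fin k → Vect n) :
    sEnd (fun i => (X i).toLinearMap) = (sRsym X).toLinearMap := by
  have hk1 : 1 ≤ k := by nlinarith [Nat.sub_le_iff_le_add.mp hk]
  refine LinearMap.ext fun f => MvPolynomial.funext fun e => ?_
  change _ = eval e (sRsym X f)
  rw [← coeff_zero_trl, ← coeff_zero_trl, ← sEnd_conj]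
  have := main0 hn hk (fun i => conjD (trl e) (X i)) (conjD (trl e) (sRsym X)) (by
    intro i
    have h1 : (MvPolynomial.X i : MvPolynomial (Fin n) ℂ)
        = trl e ((trl e).symm (MvPolynomial.X i)) := by simp
    rw [conjD_apply, trl_symm_X]
    nth_rewrite 1 [h1]
    rw [sEnd_conj, trl_symm_X, map_sub, map_sub, sEnd_X hk1, sEnd_C hk1]
    have h2 : sRsym X (C (e i)) = 0 := Derivation.map_algebraMap (sRsym X) (e i)
    rw [map_sub, h2, map_sub]) (trl e f)
  rw [this, conjD_apply, AlgEquiv.symm_apply_apply]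
end

section
/- Let n ≥ 2 and set N = n² + 2n − 2. For all derivations X₁, …, X_{2N−1} ∈ Derivation ℂ A_n A_n one has ∑_{σ ∈ Equiv.Perm (Fin (2N−2))} (sign σ) • s_N(X_{σ(1)}, …, X_{σ(N−1)}, s_N(X_{σ(N)}, …, X_{σ(2N−2)}, X_{2N−1})) = 0, where every occurrence of s_N is computed as the alternating sum of compositions of ℂ-linear endomorphisms of A_n. That is, the algebra (Vect(n), s_N) is (N−1)-left commutative. -/
namespace LeftComm

open MvPolynomial

/-- The maximal ideal of the point `p`. -/
noncomputable def ptIdeal {n : ℕ} (p : Fin n → ℂ) : Ideal (MvPolynomial (Fin n) ℂ) :=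
  RingHom.ker (MvPolynomial.eval p)

/-- `T` raises the order of vanishing at `p` by at least `d`. -/
noncomputable def HasDeg {n : ℕ} (p : Fin n → ℂ) (T : Module.End ℂ (MvPolynomial (Fin n) ℂ)) (d : ℤ) : Prop :=
  ∀ (k : ℤ) (f : MvPolynomial (Fin n) ℂ),
    f ∈ ptIdeal p ^ k.toNat → T f ∈ ptIdeal p ^ (k + d).toNat

lemma hasDeg_one {n : ℕ} (p : Fin n → ℂ) : HasDeg p 1 0 := by
  intro k f hf
  simpa using hf

lemma HasDeg.mul {n : ℕ} {p : Fin n → ℂ} {S T : Module.End ℂ (MvPolynomial (Fin n) ℂ)}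
    {a b : ℤ} (hS : HasDeg p S a) (hT : HasDeg p T b) : HasDeg p (S * T) (a + b) := by
  intro k f hf
  have := hS _ _ (hT k f hf)
  rwa [show k + (a + b) = k + b + a by ring]

lemma HasDeg.zsmul {n : ℕ} {p : Fin n → ℂ} {T : Module.End ℂ (MvPolynomial (Fin n) ℂ)}
    {a : ℤ} (hT : HasDeg p T a) (c : ℤ) : HasDeg p (c • T) a := by
  intro k f hf
  rw [LinearMap.smul_apply]
  exact zsmul_mem (hT k f hf) c

lemma HasDeg.sum {n : ℕ} {p : Fin n → ℂ} {ι : Type*} (s : Finset ι)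
    {T : ι → Module.End ℂ (MvPolynomial (Fin n) ℂ)}
    {a : ℤ} (hT : ∀ i, HasDeg p (T i) a) : HasDeg p (∑ i ∈ s, T i) a := by
  intro k f hf
  rw [LinearMap.sum_apply]
  exact sum_mem fun i _ => hT i k f hf

lemma hasDeg_listProd {n : ℕ} {p : Fin n → ℂ} {k : ℕ}
    (T : Fin k → Module.End ℂ (MvPolynomial (Fin n) ℂ)) (d : Fin k → ℤ)
    (h : ∀ i, HasDeg p (T i) (d i)) :
    HasDeg p (List.ofFn T).reverse.prod (∑ i, d i) := by
  induction k with
  | zero => simpa using hasDeg_one p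
  | succ k ih =>
    rw [List.ofFn_succ, List.reverse_cons, List.prod_append, Fin.sum_univ_succ,
      add_comm (d 0)]
    refine HasDeg.mul (ih _ _ fun i => h i.succ) ?_
    simpa using h 0

lemma hasDeg_sEnd {n : ℕ} {p : Fin n → ℂ} {k : ℕ}
    (T : Fin k → Module.End ℂ (MvPolynomial (Fin n) ℂ)) (d : Fin k → ℤ)
    (h : ∀ i, HasDeg p (T i) (d i)) : HasDeg p (sEnd T) (∑ i, d i) := by
  unfold sEnd
  refine HasDeg.sum _ fun σ => HasDeg.zsmul ?_ _
  rw [← Equiv.sum_comp σ d]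
  exact hasDeg_listProd _ _ fun i => h _

lemma hasDeg_derivation {n : ℕ} {p : Fin n → ℂ} (D : Vect n) (a : ℕ)
    (h : ∀ f, D f ∈ ptIdeal p ^ a) : HasDeg p D.toLinearMap ((a : ℤ) - 1) := by
  have key : ∀ (k : ℕ) (f : MvPolynomial (Fin n) ℂ), f ∈ ptIdeal p ^ (k + 1) →
      D f ∈ ptIdeal p ^ (a + k) := by
    intro k
    induction k with
    | zero => intro f _; exact h f
    | succ k ih =>
      intro f hf
      rw [pow_succ] at hf
      refine Submodule.mul_induction_on hf ?_ ?_
      · intro u hu v hv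
        rw [Derivation.leibniz, smul_eq_mul, smul_eq_mul]
        refine add_mem ?_ ?_
        · have := Ideal.mul_mem_mul hu (h v)
          rw [← pow_add] at this
          rwa [show a + (k + 1) = k + 1 + a by ring]
        · have := Ideal.mul_mem_mul hv (ih u hu)
          rw [← pow_succ'] at this
          exact this
      · intro u v hu hv
        rw [map_add]
        exact add_mem hu hv
  intro k f hf
  change D f ∈ _
  rcases le_or_gt k 0 with hk | hk
  · exact Ideal.pow_le_pow_right (by omega) (h f)
  · obtain ⟨m, rfl⟩ : ∃ m : ℕ, k = m + 1 := ⟨(k - 1).toNat, by omega⟩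
    have := key m f (by simpa using hf)
    rwa [show ((m : ℤ) + 1 + ((a : ℤ) - 1)).toNat = a + m by omega]

/-- Translation automorphism. -/
noncomputable def trans {n : ℕ} (p : Fin n → ℂ) : MvPolynomial (Fin n) ℂ ≃ₐ[ℂ] MvPolynomial (Fin n) ℂ :=
  AlgEquiv.ofAlgHom (aeval fun i => X i - C (p i)) (aeval fun i => X i + C (p i))
    (by ext i; simp) (by ext i; simp)

lemma trans_monomial_mem {n : ℕ} (p : Fin n → ℂ) (α : Fin n →₀ ℕ) :
    trans p (monomial α 1) ∈ ptIdeal p ^ (∑ i, α i) := by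
  have : trans p (monomial α 1) = ∏ i, (X i - C (p i)) ^ α i := by
    simp only [trans, AlgEquiv.ofAlgHom_apply, aeval_monomial, map_one, one_mul]
    rw [Finsupp.prod_fintype]
    simp
  rw [this, ← Finset.prod_pow_eq_pow_sum]
  refine Ideal.prod_mem_prod fun i _ => Ideal.pow_mem_pow ?_ _
  simp [ptIdeal, RingHom.mem_ker]

/-- The basis `(x-p)^α ∂_i` of the space of vector fields. -/
noncomputable def vbasis {n : ℕ} (p : Fin n → ℂ) : Module.Basis (Σ _ : Fin n, (Fin n →₀ ℕ)) ℂ (Vect n) :=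
  (Pi.basis fun _ : Fin n =>
    (basisMonomials (Fin n) ℂ).map (trans p).toLinearEquiv).map (mkDerivationEquiv ℂ)

lemma vbasis_mem {n : ℕ} (p : Fin n → ℂ) (b : Σ _ : Fin n, (Fin n →₀ ℕ))
    (f : MvPolynomial (Fin n) ℂ) : vbasis p b f ∈ ptIdeal p ^ (∑ i, b.2 i) := by
  obtain ⟨i, α⟩ := b
  have : vbasis p ⟨i, α⟩ = mkDerivation ℂ (Pi.single i (trans p (monomial α 1))) := by
    simp only [vbasis, Module.Basis.map_apply, Pi.basis_apply]
    simp [mkDerivationEquiv]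
  rw [this]
  have hc : ∀ j, (Pi.single i (trans p (monomial α 1)) : Fin n → MvPolynomial (Fin n) ℂ) j ∈
      ptIdeal p ^ (∑ i, α i) := by
    intro j
    rcases eq_or_ne j i with rfl | hj
    · rw [Pi.single_eq_same]
      exact trans_monomial_mem p α
    · rw [Pi.single_eq_of_ne hj]
      exact zero_mem _
  induction f using MvPolynomial.induction_on' with
  | monomial s r =>
    rw [mkDerivation_monomial, MvPolynomial.smul_eq_C_mul]
    refine Ideal.mul_mem_left _ _ (sum_mem fun j _ => ?_)
    exact Ideal.mul_mem_left _ _ (hc j)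
  | add u v hu hv =>
    rw [map_add]
    exact add_mem hu hv

lemma count {n M : ℕ} (v : Fin M → Σ _ : Fin n, (Fin n →₀ ℕ)) (hv : Function.Injective v) :
    (M : ℤ) - 2 * n - n ^ 2 ≤ ∑ i, (((∑ j, (v i).2 j : ℕ) : ℤ) - 1) := by
  classical
  set w : Fin M → ℕ := fun i => ∑ j, (v i).2 j with hw
  have h0 : (Finset.univ.filter fun i => w i = 0).card ≤ n := by
    have := Finset.card_le_card_of_injOn (s := Finset.univ.filter fun i => w i = 0)
      (t := (Finset.univ : Finset (Fin n))) (fun i => (v i).1) (by simp) ?_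
    · simpa using this
    · intro a ha b hb hab
      simp [hw] at ha hb
      apply hv
      refine Sigma.ext hab (heq_of_eq ?_)
      ext j
      simp [ha, hb]
  have h1 : (Finset.univ.filter fun i => w i = 1).card ≤ n ^ 2 := by
    have hex : ∀ i, w i = 1 → ∃ j, (v i).2 = Finsupp.single j 1 := by
      intro i hi
      have hne : ∃ j, (v i).2 j ≠ 0 := by
        by_contra! hcon
        simp [hw, hcon] at hi
      obtain ⟨j, hj⟩ := hne
      refine ⟨j, ?_⟩
      have hsplit : (v i).2 j + ∑ l ∈ Finset.univ.erase j, (v i).2 l = 1 := by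
        rw [Finset.add_sum_erase _ _ (Finset.mem_univ j)]
        exact hi
      have hz : ∑ l ∈ Finset.univ.erase j, (v i).2 l = 0 := by omega
      rw [Finset.sum_eq_zero_iff] at hz
      ext l
      rcases eq_or_ne l j with rfl | hl
      · rw [Finsupp.single_eq_same]; omega
      · rw [Finsupp.single_eq_of_ne hl]
        exact hz l (by simp [hl])
    have hex' : ∀ i, ∃ j : Option (Fin n), w i = 1 → ∃ j', j = some j' ∧
        (v i).2 = Finsupp.single j' 1 := by
      intro i
      by_cases h : w i = 1
      · obtain ⟨j, hj⟩ := hex i h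
        exact ⟨some j, fun _ => ⟨j, rfl, hj⟩⟩
      · exact ⟨none, fun h' => absurd h' h⟩
    choose g hg using hex'
    have := Finset.card_le_card_of_injOn (s := Finset.univ.filter fun i => w i = 1)
      (t := (Finset.univ : Finset (Fin n × Fin n)))
      (fun i => ((v i).1, (g i).getD (v i).1)) (by simp) ?_
    · simpa [sq] using this
    · intro a ha b hb hab
      simp only [Finset.coe_filter, Finset.mem_univ, true_and, Set.mem_ofPred_eq] at ha hb
      obtain ⟨ja, hja, ha'⟩ := hg a ha
      obtain ⟨jb, hjb, hb'⟩ := hg b hb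
      simp only [hja, hjb, Option.getD_some, Prod.mk.injEq] at hab
      apply hv
      refine Sigma.ext hab.1 (heq_of_eq ?_)
      rw [ha', hb', hab.2]
  have hpt : ∀ i, (1 : ℤ) - 2 * (if w i = 0 then 1 else 0) - (if w i = 1 then 1 else 0)
      ≤ (w i : ℤ) - 1 := by
    intro i
    split_ifs <;> omega
  have hs := Finset.sum_le_sum fun i (_ : i ∈ (Finset.univ : Finset (Fin M))) => hpt i
  rw [Finset.sum_sub_distrib, Finset.sum_sub_distrib, ← Finset.mul_sum, Finset.sum_boole,
    Finset.sum_boole] at hs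
  simp only [Finset.sum_const, Finset.card_univ, Fintype.card_fin, nsmul_eq_mul, mul_one] at hs
  have h0' : ((Finset.univ.filter fun i => w i = 0).card : ℤ) ≤ n := by exact_mod_cast h0
  have h1' : ((Finset.univ.filter fun i => w i = 1).card : ℤ) ≤ (n : ℤ) ^ 2 := by
    exact_mod_cast h1
  linarith

/-- The reversed product as a multilinear map. -/
noncomputable def revProd {A : Type*} [AddCommGroup A] [Module ℂ A] (k : ℕ) :
    MultilinearMap ℂ (fun _ : Fin k => Module.End ℂ A) (Module.End ℂ A) :=
  (MultilinearMap.mkPiAlgebraFin ℂ k (Module.End ℂ A)).domDomCongr Fin.revPerm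

lemma revProd_apply {A : Type*} [AddCommGroup A] [Module ℂ A] (k : ℕ)
    (T : Fin k → Module.End ℂ A) : revProd k T = (List.ofFn T).reverse.prod := by
  rw [revProd, MultilinearMap.domDomCongr_apply, MultilinearMap.mkPiAlgebraFin_apply]
  congr 1
  apply List.ext_getElem
  · simp
  · intro i h1 h2
    simp only [List.getElem_ofFn, List.getElem_reverse, List.length_ofFn]
    congr 1
    simp [Fin.ext_iff]
    omega

/-- `sEnd` as a multilinear map. -/
noncomputable def sEndM {A : Type*} [AddCommGroup A] [Module ℂ A] (k : ℕ) :
    MultilinearMap ℂ (fun _ : Fin k => Module.End ℂ A) (Module.End ℂ A) :=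
  (MultilinearMap.alternatization (revProd k)).toMultilinearMap

lemma sEndM_apply {A : Type*} [AddCommGroup A] [Module ℂ A] (k : ℕ)
    (T : Fin k → Module.End ℂ A) : sEndM k T = sEnd T := by
  simp only [sEndM, AlternatingMap.coe_multilinearMap, MultilinearMap.alternatization_apply, sEnd,
    MultilinearMap.domDomCongr_apply, revProd_apply]
  rfl

/-- Arguments: `K` vector fields, then a last operator. -/
noncomputable def args {A : Type*} [AddCommGroup A] [Module ℂ A] {K : ℕ} (v : Fin K → Module.End ℂ A)
    (Z : Module.End ℂ A) : Fin (K + 1) → Module.End ℂ A :=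
  Fin.snoc (α := fun _ => Module.End ℂ A) v Z

/-- The nested operator. -/
noncomputable def nested {A : Type*} [AddCommGroup A] [Module ℂ A] {K : ℕ} (Y : Module.End ℂ A)
    (v : Fin (K + K) → Module.End ℂ A) : Module.End ℂ A :=
  sEnd (args (fun i => v (Fin.castAdd K i)) (sEnd (args (fun i => v (Fin.natAdd K i)) Y)))

lemma sEnd_snoc_add {A : Type*} [AddCommGroup A] [Module ℂ A] {K : ℕ} 
    (v : Fin K → Module.End ℂ A) (Z Z' : Module.End ℂ A) :
    sEnd (args v (Z + Z')) = sEnd (args v Z) + sEnd (args v Z') := by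
  simp only [← sEndM_apply, args]
  have h := (sEndM (A := A) (K + 1)).map_update_add (args v 0) (Fin.last K) Z Z'
  simpa only [args, Fin.update_snoc_last] using h

lemma sEnd_snoc_smul {A : Type*} [AddCommGroup A] [Module ℂ A] {K : ℕ} 
    (v : Fin K → Module.End ℂ A) (c : ℂ) (Z : Module.End ℂ A) :
    sEnd (args v (c • Z)) = c • sEnd (args v Z) := by
  simp only [← sEndM_apply, args]
  have h := (sEndM (A := A) (K + 1)).map_update_smul (args v 0) (Fin.last K) c Z
  simpa only [args, Fin.update_snoc_last] using h

lemma sEnd_update_add {A : Type*} [AddCommGroup A] [Module ℂ A] {K : ℕ}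
    (v : Fin K → Module.End ℂ A) (i : Fin K) (x y Z : Module.End ℂ A) :
    sEnd (args (Function.update v i (x + y)) Z) =
      sEnd (args (Function.update v i x) Z) + sEnd (args (Function.update v i y) Z) := by
  simp only [← sEndM_apply, args]
  have h := (sEndM (A := A) (K + 1)).map_update_add (args v Z) (Fin.castSucc i) x y
  simpa only [args, Fin.snoc_update] using h

lemma sEnd_update_smul {A : Type*} [AddCommGroup A] [Module ℂ A] {K : ℕ}
    (v : Fin K → Module.End ℂ A) (i : Fin K) (c : ℂ) (x Z : Module.End ℂ A) :
    sEnd (args (Function.update v i (c • x)) Z) =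
      c • sEnd (args (Function.update v i x) Z) := by
  simp only [← sEndM_apply, args]
  have h := (sEndM (A := A) (K + 1)).map_update_smul (args v Z) (Fin.castSucc i) c x
  simpa only [args, Fin.snoc_update] using h

lemma upd_castAdd_left {B : Type*} {K : ℕ} (v : Fin (K + K) → B) (i : Fin K) (x : B) :
    (fun j => Function.update v (Fin.castAdd K i) x (Fin.castAdd K j)) =
      Function.update (fun j => v (Fin.castAdd K j)) i x :=
  Function.update_comp_eq_of_injective v (Fin.castAdd_injective K K) i x

lemma upd_castAdd_right {B : Type*} {K : ℕ} (v : Fin (K + K) → B) (i : Fin K) (x : B) :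
    (fun j => Function.update v (Fin.castAdd K i) x (Fin.natAdd K j)) =
      (fun j => v (Fin.natAdd K j)) := by
  funext j
  apply Function.update_of_ne
  simp [Fin.ext_iff]
  omega

lemma upd_natAdd_left {B : Type*} {K : ℕ} (v : Fin (K + K) → B) (i : Fin K) (x : B) :
    (fun j => Function.update v (Fin.natAdd K i) x (Fin.castAdd K j)) =
      (fun j => v (Fin.castAdd K j)) := by
  funext j
  apply Function.update_of_ne
  simp [Fin.ext_iff]
  omega

lemma upd_natAdd_right {B : Type*} {K : ℕ} (v : Fin (K + K) → B) (i : Fin K) (x : B) :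
    (fun j => Function.update v (Fin.natAdd K i) x (Fin.natAdd K j)) =
      Function.update (fun j => v (Fin.natAdd K j)) i x :=
  Function.update_comp_eq_of_injective v (Fin.natAdd_injective K K) i x

/-- `nested` as a multilinear map. -/
noncomputable def nestedM {A : Type*} [AddCommGroup A] [Module ℂ A] (K : ℕ) (Y : Module.End ℂ A) :
    MultilinearMap ℂ (fun _ : Fin (K + K) => Module.End ℂ A) (Module.End ℂ A) where
  toFun := nested Y
  map_update_add' := by
    intro inst v i x y
    rw [Subsingleton.elim inst (instDecidableEqFin (K + K))]
    unfold nested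
    induction i using Fin.addCases with
    | left i => simp only [upd_castAdd_left, upd_castAdd_right, sEnd_update_add]
    | right i => simp only [upd_natAdd_left, upd_natAdd_right, sEnd_update_add, sEnd_snoc_add]
  map_update_smul' := by
    intro inst v i c x
    rw [Subsingleton.elim inst (instDecidableEqFin (K + K))]
    unfold nested
    induction i using Fin.addCases with
    | left i => simp only [upd_castAdd_left, upd_castAdd_right, sEnd_update_smul]
    | right i => simp only [upd_natAdd_left, upd_natAdd_right, sEnd_update_smul, sEnd_snoc_smul]

/-- The underlying endomorphism, linearly. -/
noncomputable def toEnd (n : ℕ) : Vect n →ₗ[ℂ] Module.End ℂ (MvPolynomial (Fin n) ℂ) where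
  toFun D := D.toLinearMap
  map_add' _ _ := rfl
  map_smul' _ _ := rfl

lemma hasDeg_args {n : ℕ} {p : Fin n → ℂ} {K : ℕ}
    (v : Fin K → Module.End ℂ (MvPolynomial (Fin n) ℂ)) (Z : Module.End ℂ (MvPolynomial (Fin n) ℂ))
    (d : Fin K → ℤ) (e : ℤ) (hv : ∀ i, HasDeg p (v i) (d i)) (hZ : HasDeg p Z e) :
    HasDeg p (sEnd (args v Z)) (∑ i, d i + e) := by
  have := hasDeg_sEnd (p := p) (args v Z) (Fin.snoc (α := fun _ => ℤ) d e) (by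
    intro i
    induction i using Fin.lastCases with
    | last => simpa [args] using hZ
    | cast i => simpa [args] using hv i)
  simpa [Fin.sum_univ_castSucc] using this

lemma hasDeg_nested {n : ℕ} {p : Fin n → ℂ} {K : ℕ}
    (v : Fin (K + K) → Module.End ℂ (MvPolynomial (Fin n) ℂ))
    (Y : Module.End ℂ (MvPolynomial (Fin n) ℂ))
    (d : Fin (K + K) → ℤ) (e : ℤ) (hv : ∀ i, HasDeg p (v i) (d i)) (hY : HasDeg p Y e) :
    HasDeg p (nested Y v) (∑ i, d i + e) := by
  rw [Fin.sum_univ_add, add_assoc]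
  exact hasDeg_args _ _ _ _ (fun i => hv _) (hasDeg_args _ _ _ _ (fun i => hv _) hY)

theorem main {n K : ℕ} (hK : n ^ 2 + 2 * n + 2 ≤ K + K) (Y : Vect n) (v : Fin (K + K) → Vect n) :
    ∑ σ : Equiv.Perm (Fin (K + K)), (Equiv.Perm.sign σ : ℤ) •
      nested Y.toLinearMap (fun i => (v (σ i)).toLinearMap) = 0 := by
  refine LinearMap.ext fun f => ?_
  apply MvPolynomial.funext
  intro p
  let φ : Module.End ℂ (MvPolynomial (Fin n) ℂ) →ₗ[ℂ] ℂ :=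
    (MvPolynomial.aeval p).toLinearMap ∘ₗ LinearMap.applyₗ f
  let m : MultilinearMap ℂ (fun _ : Fin (K + K) => Vect n) ℂ :=
    φ.compMultilinearMap ((nestedM K Y.toLinearMap).compLinearMap fun _ => toEnd n)
  have hm : ∀ u, m u = MvPolynomial.eval p (nested Y.toLinearMap (fun i => (u i).toLinearMap) f) :=
    fun u => rfl
  have hz : MultilinearMap.alternatization m = 0 := by
    refine Module.Basis.ext_alternating (vbasis p) fun b hb => ?_
    rw [MultilinearMap.alternatization_apply]
    simp only [AlternatingMap.zero_apply]
    refine Finset.sum_eq_zero fun σ _ => ?_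
    rw [MultilinearMap.domDomCongr_apply, hm]
    have hd := hasDeg_nested (p := p) (fun i => (vbasis p (b (σ i))).toLinearMap) Y.toLinearMap
      (fun i => (((∑ j, (b (σ i)).2 j : ℕ) : ℤ) - 1)) (((0 : ℕ) : ℤ) - 1)
      (fun i => hasDeg_derivation _ _ (vbasis_mem p _))
      (hasDeg_derivation _ _ (by simp)) 0 f (by simp)
    have hc := count (fun i => b (σ i)) (hb.comp σ.injective)
    have hK' : (n : ℤ) ^ 2 + 2 * n + 2 ≤ ((K + K : ℕ) : ℤ) := by exact_mod_cast hK
    have h1 := Ideal.pow_le_pow_right (I := ptIdeal p) (m := 1) (by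
      rw [Int.le_toNat (by linarith)]
      push_cast at *
      linarith) hd
    rw [pow_one] at h1
    rw [show MvPolynomial.eval p _ = 0 from h1, smul_zero]
  have := congrArg (fun a => a v) hz
  simp only [MultilinearMap.alternatization_apply, AlternatingMap.zero_apply,
    MultilinearMap.domDomCongr_apply, hm] at this
  rw [LinearMap.zero_apply, map_zero]
  rw [LinearMap.sum_apply, map_sum, ← this]
  refine Finset.sum_congr rfl fun σ _ => ?_
  rw [LinearMap.smul_apply, map_zsmul]
  rfl

end LeftComm

/-- for `n ≥ 2` and `N = n² + 2n − 2`, `(Vect(n), s_N)` is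
`(N−1)`-left commutative. -/
theorem stmt_2 (n : ℕ) (hn : 2 ≤ n) (N : ℕ) (hN : N = n ^ 2 + 2 * n - 2)
    (X : Fin (2 * N - 1) → Vect n) :
    ∑ σ : Equiv.Perm (Fin (2 * N - 2)),
      (Equiv.Perm.sign σ : ℤ) •
        sEnd (fun j : Fin N =>
          if h : (j : ℕ) < N - 1 then
            (X (Fin.castLE (show 2 * N - 2 ≤ 2 * N - 1 by omega)
              (σ ⟨(j : ℕ), by omega⟩))).toLinearMap
          else
            sEnd (fun l : Fin N =>
              if hl : (l : ℕ) < N - 1 then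
                (X (Fin.castLE (show 2 * N - 2 ≤ 2 * N - 1 by omega)
                  (σ ⟨N - 1 + (l : ℕ), by omega⟩))).toLinearMap
              else
                (X ⟨2 * N - 2, by
                  revert hN; generalize n ^ 2 = m; intro hN; omega⟩).toLinearMap)) = 0 := by
  have hn2 : 4 ≤ n ^ 2 := by nlinarith
  obtain ⟨K, rfl⟩ : ∃ K, N = K + 1 := ⟨N - 1, by omega⟩
  have hM : 2 * (K + 1) - 2 = K + K := by omega
  have hK : n ^ 2 + 2 * n + 2 ≤ K + K := by omega
  have hmain := LeftComm.main hK (X ⟨2 * (K + 1) - 2, by omega⟩)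
    (fun i => X ⟨i, by omega⟩)
  rw [← Equiv.sum_comp (finCongr hM).permCongr] at hmain
  rw [← hmain]
  refine Finset.sum_congr rfl fun σ _ => ?_
  rw [Equiv.Perm.sign_permCongr]
  congr 1
end

section
/- There exist divergence-free derivations X₁, …, X₅ ∈ Derivation ℂ A₂ A₂ such that s₅(X₁, …, X₅) ≠ 0 as a ℂ-linear endomorphism of A₂; that is, the 5-commutator s₅ is nontrivial on divergence-free vector fields in two variables. -/
open MvPolynomial in
/-- Hamiltonian field of `x^a y^b`. -/
noncomputable def hamField (a b : ℕ) : Vect 2 :=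
  mkDerivation ℂ ![C (b : ℂ) * X 0 ^ a * X 1 ^ (b - 1), - (C (a : ℂ) * X 0 ^ (a - 1) * X 1 ^ b)]

/-- Integer multiple of a monomial. -/
noncomputable def evState (s : ℤ × ℕ × ℕ) : MvPolynomial (Fin 2) ℂ :=
  MvPolynomial.C (s.1 : ℂ) * MvPolynomial.X 0 ^ s.2.1 * MvPolynomial.X 1 ^ s.2.2

/-- Action of `hamField a b` on a multiple of a monomial. -/
def stepState (s : ℤ × ℕ × ℕ) (h : ℕ × ℕ) : ℤ × ℕ × ℕ :=
  (s.1 * (h.2 * s.2.1 - h.1 * s.2.2), h.1 + s.2.1 - 1, h.2 + s.2.2 - 1)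

/-- Constant term. -/
def constState (s : ℤ × ℕ × ℕ) : ℤ := if s.2.1 = 0 ∧ s.2.2 = 0 then s.1 else 0

/-- Exponents of the chosen Hamiltonians `y, x, y², xy, x²y`. -/
def hamExp : Fin 5 → ℕ × ℕ := ![(0, 1), (1, 0), (0, 2), (1, 1), (2, 1)]

theorem hamField_X0 (a b : ℕ) : hamField a b (MvPolynomial.X 0) =
    MvPolynomial.C (b : ℂ) * MvPolynomial.X 0 ^ a * MvPolynomial.X 1 ^ (b - 1) := by
  simp [hamField, MvPolynomial.mkDerivation_X]

theorem hamField_X1 (a b : ℕ) : hamField a b (MvPolynomial.X 1) =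
    - (MvPolynomial.C (a : ℂ) * MvPolynomial.X 0 ^ (a - 1) * MvPolynomial.X 1 ^ b) := by
  simp [hamField, MvPolynomial.mkDerivation_X]

theorem hamField_evState (h : ℕ × ℕ) (s : ℤ × ℕ × ℕ) :
    hamField h.1 h.2 (evState s) = evState (stepState s h) := by
  obtain ⟨a, b⟩ := h
  obtain ⟨c, p, q⟩ := s
  have hC : hamField a b (MvPolynomial.C (c : ℂ)) = 0 := MvPolynomial.derivation_C _ _
  simp only [evState, stepState, Derivation.leibniz, Derivation.leibniz_pow, hamField_X0,
    hamField_X1, hC, smul_eq_mul, nsmul_eq_mul]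
  rcases a with _ | a <;> rcases b with _ | b <;> rcases p with _ | p <;> rcases q with _ | q <;>
    simp [← add_assoc, Nat.add_right_comm _ 1] <;> ring

theorem divg_hamField (a b : ℕ) : divg (hamField a b) = 0 := by
  simp only [divg, Fin.sum_univ_two, hamField_X0, hamField_X1]
  simp [Derivation.leibniz, Derivation.leibniz_pow, MvPolynomial.pderiv_X]
  ring

theorem prod_apply_evState (L : List (ℕ × ℕ)) (s : ℤ × ℕ × ℕ) :
    ((L.map fun h => ((hamField h.1 h.2).toLinearMap :
      Module.End ℂ (MvPolynomial (Fin 2) ℂ))).reverse.prod) (evState s)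
      = evState (L.foldl stepState s) := by
  induction L generalizing s with
  | nil => simp
  | cons h t ih =>
    simp only [List.map_cons, List.reverse_cons, List.prod_append, List.prod_singleton,
      Module.End.mul_apply, List.foldl_cons]
    rw [← ih, ← hamField_evState]
    rfl

theorem constantCoeff_evState (s : ℤ × ℕ × ℕ) :
    MvPolynomial.constantCoeff (evState s) = (constState s : ℂ) := by
  obtain ⟨c, p, q⟩ := s
  rcases p with _ | p <;> rcases q with _ | q <;> simp [evState, constState]

theorem alternating_sum_value :
    ∑ σ : Equiv.Perm (Fin 5), (Equiv.Perm.sign σ : ℤ) *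
      constState ((List.ofFn fun i => hamExp (σ i)).foldl stepState (1, 1, 0)) = -12 := by
  decide +kernel

/-- the 5-commutator `s₅` is nontrivial on divergence-free vector
fields in two variables. -/
theorem stmt_5 :
    ∃ X : Fin 5 → Vect 2,
      (∀ i, divg (X i) = 0) ∧ sEnd (fun i => (X i).toLinearMap) ≠ 0 := by
  refine ⟨fun i => hamField (hamExp i).1 (hamExp i).2, fun i => divg_hamField _ _, fun h0 => ?_⟩
  have h1 := congrArg (fun T : Module.End ℂ (MvPolynomial (Fin 2) ℂ) =>
    MvPolynomial.constantCoeff (T (evState (1, 1, 0)))) h0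
  have h2 : ∀ σ : Equiv.Perm (Fin 5),
      (List.ofFn fun i => ((hamField (hamExp (σ i)).1 (hamExp (σ i)).2).toLinearMap :
        Module.End ℂ (MvPolynomial (Fin 2) ℂ))) =
      (List.ofFn fun i => hamExp (σ i)).map fun h => (hamField h.1 h.2).toLinearMap := by
    intro σ
    rw [List.map_ofFn]
    rfl
  simp only [sEnd, h2, LinearMap.sum_apply, LinearMap.smul_apply, prod_apply_evState, map_sum,
    map_zsmul, constantCoeff_evState, LinearMap.zero_apply, map_zero] at h1
  have h3 := congrArg (Int.cast : ℤ → ℂ) alternating_sum_value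
  simp only [zsmul_eq_mul] at h1
  push_cast at h3 h1
  rw [h1] at h3
  norm_num at h3
end

section
/- For all divergence-free derivations X₁, …, X₆ ∈ Derivation ℂ A₂ A₂ one has s₆(X₁, …, X₆) = 0 as a ℂ-linear endomorphism of A₂; that is, s₆ = 0 is an identity on divergence-free vector fields in two variables. -/
section S6core
set_option linter.unusedSimpArgs false

theorem s6_core {B : Type*} [Ring B] (dx dy : B →+ B) (J : ℕ → B)
    (Lx : ∀ a b, dx (a * b) = dx a * b + a * dx b)
    (Ly : ∀ a b, dy (a * b) = dy a * b + a * dy b)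
    (hc : ∀ a, dy (dx a) = dx (dy a))
    (sq : ∀ i, J i * J i = 0)
    (anti : ∀ i j, J i * J j = -(J j * J i))
    (x0 : dx (J 0) = J 2) (x1 : dx (J 1) = J 4) (x2 : dx (J 2) = J 5) (x3 : dx (J 3) = J 6)
    (x4 : dx (J 4) = J 8) (x5 : dx (J 5) = J 9) (x6 : dx (J 6) = J 10) (x7 : dx (J 7) = J 11)
    (x8 : dx (J 8) = J 13)
    (y0 : dy (J 0) = J 3) (y1 : dy (J 1) = - J 2) (y2 : dy (J 2) = J 6) (y3 : dy (J 3) = J 7)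
    (y4 : dy (J 4) = - J 5) (y5 : dy (J 5) = J 10) (y6 : dy (J 6) = J 11) (y7 : dy (J 7) = J 12)
    (y8 : dy (J 8) = - J 9) (T : B → B) (hT : ∀ g, T g = J 0 * dx g + J 1 * dy g) (g : B) :
    T (T (T (T (T (T g))))) = 0 := by
  have sq' : ∀ i z, J i * (J i * z) = 0 := fun i z => by rw [← mul_assoc, sq, zero_mul]
  have an : ∀ i j, j < i → J i * J j = -(J j * J i) := fun i j _ => anti i j
  have an' : ∀ i j z, j < i → J i * (J j * z) = -(J j * (J i * z)) := fun i j z _ => by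
    rw [← mul_assoc, anti, neg_mul, mul_assoc]
  have hY : ∀ g, T (T g) = J 0 * (J 2 * dx g) + J 1 * (J 3 * dx g) + J 0 * (J 4 * dy g)
      - J 1 * (J 2 * dy g) := by
    intro g
    simp [hT, Lx, Ly, hc, sq, sq', an, an', x0, x1, y0, y1, mul_add, add_mul, mul_assoc]
    abel
  simp only [hY]
  simp [Lx, Ly, hc, sq, sq', an, an', x0, x1, y0, y1, x2, x3, x4, x5, x6, x7, x8,
    y2, y3, y4, y5, y6, y7, y8, mul_add, add_mul, mul_sub, sub_mul, mul_assoc]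
  abel

end S6core

section S6tensor
open TensorProduct MvPolynomial

abbrev S6L : Type := ExteriorAlgebra ℂ (Fin 6 → ℂ)
abbrev S6A : Type := MvPolynomial (Fin 2) ℂ
abbrev S6B : Type := S6L ⊗[ℂ] S6A

noncomputable def s6xi (i : Fin 6) : S6L := ExteriorAlgebra.ι ℂ (Pi.single i (1 : ℂ))

noncomputable def s6od (F : Fin 6 → S6A) : S6B := ∑ i, s6xi i ⊗ₜ[ℂ] F i

noncomputable def s6d (k : Fin 2) : S6B →ₗ[ℂ] S6B :=
  LinearMap.lTensor S6L (pderiv (R := ℂ) k).toLinearMap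

theorem s6d_tmul (k : Fin 2) (w : S6L) (f : S6A) : s6d k (w ⊗ₜ f) = w ⊗ₜ pderiv k f := rfl

theorem s6d_od (k : Fin 2) (F : Fin 6 → S6A) : s6d k (s6od F) = s6od (fun i => pderiv k (F i)) := by
  simp [s6od, s6d_tmul]

theorem s6d_mul_tmul (k : Fin 2) (w w' : S6L) (f f' : S6A) :
    s6d k ((w ⊗ₜ f) * (w' ⊗ₜ f')) = s6d k (w ⊗ₜ f) * (w' ⊗ₜ f') + (w ⊗ₜ f) * s6d k (w' ⊗ₜ f') := by
  rw [Algebra.TensorProduct.tmul_mul_tmul, s6d_tmul, s6d_tmul, s6d_tmul, Derivation.leibniz,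
    tmul_add, Algebra.TensorProduct.tmul_mul_tmul, Algebra.TensorProduct.tmul_mul_tmul,
    smul_eq_mul, smul_eq_mul, add_comm, mul_comm f']

theorem s6d_mul (k : Fin 2) (a b : S6B) : s6d k (a * b) = s6d k a * b + a * s6d k b := by
  induction a using TensorProduct.induction_on with
  | zero => rw [zero_mul, map_zero, zero_mul, zero_mul, add_zero]
  | add a a' h h' => rw [add_mul, map_add, map_add, h, h', add_mul, add_mul]; abel
  | tmul w f =>
    induction b using TensorProduct.induction_on with
    | zero => rw [mul_zero, map_zero, mul_zero, mul_zero, add_zero]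
    | add b b' h h' => rw [mul_add, map_add, map_add, h, h', mul_add, mul_add]; abel
    | tmul w' f' => exact s6d_mul_tmul k w w' f f'

theorem s6d_comm (a : S6B) : s6d 1 (s6d 0 a) = s6d 0 (s6d 1 a) := by
  induction a using TensorProduct.induction_on with
  | zero => simp
  | add a a' h h' => simp only [map_add, h, h']
  | tmul w f =>
    simp only [s6d_tmul]
    refine congrArg (fun z => w ⊗ₜ[ℂ] z) ?_
    have h : ⁅pderiv (R := ℂ) (1 : Fin 2), pderiv (R := ℂ) (0 : Fin 2)⁆ = 0 := by
      apply MvPolynomial.derivation_ext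
      intro i
      fin_cases i <;> simp [Derivation.commutator_apply]
    have h2 := congrArg (fun D : Vect 2 => D f) h
    simpa [Derivation.commutator_apply, sub_eq_zero] using h2

theorem s6xi_anti (i j : Fin 6) : s6xi i * s6xi j = -(s6xi j * s6xi i) := by
  rw [eq_neg_iff_add_eq_zero]
  exact ExteriorAlgebra.ι_add_mul_swap _ _

theorem s6od_anti (F G : Fin 6 → S6A) : s6od F * s6od G = -(s6od G * s6od F) := by
  simp only [s6od, Finset.sum_mul_sum, Algebra.TensorProduct.tmul_mul_tmul]
  rw [Finset.sum_comm, ← Finset.sum_neg_distrib]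
  refine Finset.sum_congr rfl fun i _ => ?_
  rw [← Finset.sum_neg_distrib]
  refine Finset.sum_congr rfl fun j _ => ?_
  rw [s6xi_anti, mul_comm (F j), neg_tmul]

theorem s6od_sq (F : Fin 6 → S6A) : s6od F * s6od F = 0 := by
  have h := s6od_anti F F
  rw [eq_neg_iff_add_eq_zero, ← two_smul ℂ] at h
  exact (smul_eq_zero.mp h).resolve_left two_ne_zero

theorem s6_deriv_apply (D : Vect 2) (f : S6A) :
    D f = D (MvPolynomial.X 0) * pderiv 0 f + D (MvPolynomial.X 1) * pderiv 1 f := by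
  have h : D = D (MvPolynomial.X 0) • pderiv (R := ℂ) 0 + D (MvPolynomial.X 1) • pderiv (R := ℂ) 1 := by
    apply MvPolynomial.derivation_ext
    intro i
    fin_cases i <;> simp
  have h2 := congrArg (fun E : Vect 2 => E f) h
  simpa using h2

noncomputable def s6T (X : Fin 6 → Vect 2) (b : S6B) : S6B :=
  s6od (fun i => X i (MvPolynomial.X 0)) * s6d 0 b + s6od (fun i => X i (MvPolynomial.X 1)) * s6d 1 b

theorem s6T_tmul (X : Fin 6 → Vect 2) (w : S6L) (f : S6A) :
    s6T X (w ⊗ₜ f) = ∑ i, (s6xi i * w) ⊗ₜ[ℂ] (X i f) := by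
  simp only [s6T, s6od, s6d_tmul, Finset.sum_mul, Algebra.TensorProduct.tmul_mul_tmul,
    ← Finset.sum_add_distrib, ← tmul_add]
  exact Finset.sum_congr rfl fun i _ => by rw [← s6_deriv_apply]

theorem s6T_sum {ι : Type*} (s : Finset ι) (X : Fin 6 → Vect 2) (b : ι → S6B) :
    s6T X (∑ i ∈ s, b i) = ∑ i ∈ s, s6T X (b i) := by
  simp only [s6T, map_sum, Finset.mul_sum, Finset.sum_add_distrib]

theorem s6T_iter (X : Fin 6 → Vect 2) (f : S6A) (k : ℕ) :
    (s6T X)^[k] (1 ⊗ₜ f) = ∑ w : Fin k → Fin 6,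
      (List.ofFn fun i => s6xi (w i)).reverse.prod ⊗ₜ[ℂ]
        ((List.ofFn fun i => ((X (w i)).toLinearMap : Module.End ℂ S6A)).reverse.prod f) := by
  induction k with
  | zero => simp
  | succ k ih =>
    rw [Function.iterate_succ_apply', ih, s6T_sum]
    simp only [s6T_tmul]
    rw [← (Fin.snocEquiv (fun _ : Fin (k + 1) => Fin 6)).sum_comp, Fintype.sum_prod_type,
      Finset.sum_comm]
    refine Finset.sum_congr rfl fun w _ => Finset.sum_congr rfl fun i _ => ?_
    rw [List.ofFn_succ', List.ofFn_succ']
    simp [Fin.snocEquiv]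

theorem s6T_six (X : Fin 6 → Vect 2) (hX : ∀ i, divg (X i) = 0) (g : S6B) :
    (s6T X)^[6] g = 0 := by
  set U : Fin 6 → S6A := fun i => X i (MvPolynomial.X 0) with hU
  set V : Fin 6 → S6A := fun i => X i (MvPolynomial.X 1) with hV
  let dd : Fin 2 → (Fin 6 → S6A) → (Fin 6 → S6A) := fun k F i => pderiv k (F i)
  let jet : ℕ → (Fin 6 → S6A) := fun n => match n with
    | 0 => U | 1 => V | 2 => dd 0 U | 3 => dd 1 U | 4 => dd 0 V
    | 5 => dd 0 (dd 0 U) | 6 => dd 0 (dd 1 U) | 7 => dd 1 (dd 1 U) | 8 => dd 0 (dd 0 V)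
    | 9 => dd 0 (dd 0 (dd 0 U)) | 10 => dd 0 (dd 0 (dd 1 U)) | 11 => dd 0 (dd 1 (dd 1 U))
    | 12 => dd 1 (dd 1 (dd 1 U)) | 13 => dd 0 (dd 0 (dd 0 V)) | _ => 0
  have e : ∀ k F, s6od (dd k F) = s6d k (s6od F) := fun k F => (s6d_od k F).symm
  have y1 : s6d 1 (s6od V) = - s6d 0 (s6od U) := by
    rw [eq_neg_iff_add_eq_zero, s6d_od, s6d_od]
    simp only [s6od, ← Finset.sum_add_distrib, ← tmul_add]
    refine Finset.sum_eq_zero fun i _ => ?_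
    have := hX i
    simp only [divg, Fin.sum_univ_two] at this
    rw [add_comm, hU, hV, this, tmul_zero]
  refine s6_core (s6d 0).toAddMonoidHom (s6d 1).toAddMonoidHom (fun n => s6od (jet n))
    (s6d_mul 0) (s6d_mul 1) s6d_comm (fun i => s6od_sq _) (fun i j => s6od_anti _ _)
    ?_ ?_ ?_ ?_ ?_ ?_ ?_ ?_ ?_ ?_ ?_ ?_ ?_ ?_ ?_ ?_ ?_ ?_ (s6T X) (fun g => rfl) g
  all_goals simp only [jet, e, LinearMap.toAddMonoidHom_coe, s6d_comm, y1, map_neg]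

noncomputable def s6alt : (Fin 6 → ℂ) [⋀^Fin 6]→ₗ[ℂ] ℂ :=
  (Matrix.detRowAlternating (n := Fin 6) (R := ℂ)).domDomCongr Fin.revPerm

noncomputable def s6phi : S6L →ₗ[ℂ] ℂ :=
  ExteriorAlgebra.liftAlternating (R := ℂ) (Pi.single 6 Matrix.detRowAlternating)

theorem s6phi_apply (w : Fin 6 → Fin 6) :
    s6phi (List.ofFn fun i => s6xi (w i)).reverse.prod =
      s6alt (fun i => Pi.single (w i) (1 : ℂ)) := by
  have h : (List.ofFn fun i => s6xi (w i)).reverse.prod =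
      ExteriorAlgebra.ιMulti ℂ 6 (fun i => Pi.single (w (Fin.rev i)) (1 : ℂ)) := by
    rw [ExteriorAlgebra.ιMulti_apply]
    simp [List.ofFn_succ, s6xi]
  rw [h, s6phi, ExteriorAlgebra.liftAlternating_apply_ιMulti, Pi.single_eq_same, s6alt,
    AlternatingMap.domDomCongr_apply]
  congr 1

theorem s6_det_one {n : Type*} [DecidableEq n] [Fintype n] :
    (Matrix.detRowAlternating (n := n) (R := ℂ)) (1 : Matrix n n ℂ) = 1 := Matrix.det_one

theorem s6_perm {n : Type*} [DecidableEq n] [Fintype n] (g : (n → ℂ) [⋀^n]→ₗ[ℂ] ℂ)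
    (v : n → n → ℂ) (σ : Equiv.Perm n) :
    g (fun i => v (σ i)) = Equiv.Perm.sign σ • g v := g.map_perm v σ

theorem s6alt_ne : s6alt (fun i => Pi.single i (1 : ℂ)) ≠ 0 := by
  have h := AlternatingMap.map_perm (Matrix.detRowAlternating (n := Fin 6) (R := ℂ))
    (fun i => Pi.single i (1 : ℂ)) Fin.revPerm
  have h1 : (Matrix.detRowAlternating (n := Fin 6) (R := ℂ)) (fun i => Pi.single i (1 : ℂ)) = 1 := by
    have : (fun i : Fin 6 => (Pi.single i (1 : ℂ) : Fin 6 → ℂ)) = (1 : Matrix (Fin 6) (Fin 6) ℂ) := by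
      ext i j
      simp [Matrix.one_apply, Pi.single_apply, eq_comm]
    rw [this]
    exact s6_det_one
  intro h0
  have h2 : s6alt (fun i => Pi.single i (1 : ℂ)) =
    Matrix.detRowAlternating ((fun i : Fin 6 => (Pi.single i (1 : ℂ) : Fin 6 → ℂ)) ∘ Fin.revPerm) := by
    rw [s6alt, AlternatingMap.domDomCongr_apply]
  rw [h2, h, h1] at h0
  rcases Int.units_eq_one_or (Equiv.Perm.sign (Fin.revPerm : Equiv.Perm (Fin 6))) with hs | hs <;>
    simp [hs] at h0

end S6tensor

/-- `s₆ = 0` is an identity on divergence-free vector fields in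
two variables. -/
theorem stmt_7 (X : Fin 6 → Vect 2) (hX : ∀ i, divg (X i) = 0) :
    sEnd (fun i => (X i).toLinearMap) = 0 := by
  refine LinearMap.ext fun f => ?_
  have h := s6T_six X hX (1 ⊗ₜ f)
  rw [s6T_iter] at h
  have h2 := congrArg (fun b => TensorProduct.lid ℂ S6A (LinearMap.rTensor S6A s6phi b)) h
  simp only [map_sum, LinearMap.rTensor_tmul, TensorProduct.lid_tmul, s6phi_apply, map_zero] at h2
  rw [← Fintype.sum_of_injective (fun σ : Equiv.Perm (Fin 6) => (σ : Fin 6 → Fin 6))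
    DFunLike.coe_injective (fun σ => s6alt (fun i => Pi.single i (1 : ℂ)) •
      ((Equiv.Perm.sign σ : ℤ) •
        (List.ofFn fun i => ((X (σ i)).toLinearMap : Module.End ℂ S6A)).reverse.prod) f)] at h2
  · rw [← Finset.smul_sum] at h2
    have h3 := (smul_eq_zero.mp h2).resolve_left s6alt_ne
    rw [sEnd, LinearMap.sum_apply, LinearMap.zero_apply]
    exact h3
  · intro w hw
    have : ¬ Function.Injective (fun i => (Pi.single (w i) (1 : ℂ) : Fin 6 → ℂ)) := by
      intro hi
      have hwi : Function.Injective w := fun a b hab => hi (by simp [hab])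
      exact hw ⟨Equiv.ofBijective w (Finite.injective_iff_bijective.mp hwi), rfl⟩
    rw [AlternatingMap.map_eq_zero_of_not_injective _ _ this, zero_smul]
  · intro σ
    have h5 := s6_perm s6alt (fun i => Pi.single i (1 : ℂ)) σ
    rw [h5]
    rcases Int.units_eq_one_or (Equiv.Perm.sign σ) with hs | hs <;> simp [hs]
end

section
/- The 5-commutator s₅ on divergence-free vector fields in two variables is primitive: there is no element f of the free Lie algebra FreeLieAlgebra ℂ (Fin 5) such that for every family X : Fin 5 → Derivation ℂ A₂ A₂ with each X i divergence-free, the image of f under the universal Lie algebra homomorphism FreeLieAlgebra.lift ℂ X equals, as a ℂ-linear endomorphism of A₂, s₅(X 0, X 1, X 2, X 3, X 4). In other words, s₅ on Vect₀(2) is not given by any Lie polynomial in its arguments. -/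
section S5proof

attribute [local instance] LieRing.ofAssociativeRing

/-- Action of the five chosen vector fields on monomials `c x^a y^b`. -/
def s5step : Fin 5 → (ℤ × ℕ × ℕ) → (ℤ × ℕ × ℕ)
  | 0, (c, a, b) => (c * b, a, b - 1)
  | 1, (c, a, b) => (c * a, a - 1, b)
  | 2, (c, a, b) => (c * b, a + 1, b - 1)
  | 3, (c, a, b) => (c * ((a : ℤ) - b), a, b)
  | 4, (c, a, b) => (c * a, a - 1, b + 2)

def s5fin (s : ℤ × ℕ × ℕ) : ℤ := if s.2.1 = 0 ∧ s.2.2 = 0 then s.1 else 0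

theorem s5_compute : (∑ σ : Equiv.Perm (Fin 5), (Equiv.Perm.sign σ : ℤ) *
    s5fin ((List.ofFn fun i => σ i).foldl (fun s i => s5step i s) (1, 1, 0))) ≠ 0 := by
  decide +kernel

noncomputable def s5mono (s : ℤ × ℕ × ℕ) : MvPolynomial (Fin 2) ℂ :=
  MvPolynomial.C (s.1 : ℂ) * (MvPolynomial.X 0 ^ s.2.1 * MvPolynomial.X 1 ^ s.2.2)

/-- The fields `∂y, ∂x, x∂y, x∂x - y∂y, y²∂x`. -/
noncomputable def s5X (i : Fin 5) : Vect 2 :=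
  MvPolynomial.mkDerivation ℂ
    ((![![0, 1], ![1, 0], ![0, MvPolynomial.X 0], ![MvPolynomial.X 0, - MvPolynomial.X 1],
      ![MvPolynomial.X 1 ^ 2, 0]] : Fin 5 → Fin 2 → MvPolynomial (Fin 2) ℂ) i)

theorem s5X_div (i : Fin 5) : divg (s5X i) = 0 := by
  fin_cases i <;> simp [divg, s5X, MvPolynomial.mkDerivation_X, MvPolynomial.pderiv_X, Fin.sum_univ_two]

theorem s5X_mono (i : Fin 5) (s : ℤ × ℕ × ℕ) : s5X i (s5mono s) = s5mono (s5step i s) := by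
  obtain ⟨c, a, b⟩ := s
  fin_cases i <;> rcases a with _ | a <;> rcases b with _ | b <;>
    simp [s5X, s5mono, s5step, Derivation.leibniz, Derivation.leibniz_pow,
      MvPolynomial.mkDerivation_X, MvPolynomial.derivation_C] <;> ring

theorem s5mono_fin (s : ℤ × ℕ × ℕ) : MvPolynomial.constantCoeff (s5mono s) = (s5fin s : ℂ) := by
  obtain ⟨c, a, b⟩ := s
  rcases a with _ | a <;> rcases b with _ | b <;> simp [s5mono, s5fin]

theorem s5_prod_apply {A : Type*} [AddCommGroup A] [Module ℂ A] (T : Fin 5 → Module.End ℂ A)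
    (l : List (Fin 5)) (v : A) :
    (l.map T).reverse.prod v = l.foldl (fun v i => T i v) v := by
  induction l generalizing v with
  | nil => simp
  | cons a l ih => simp [← ih]

theorem s5_foldl (l : List (Fin 5)) (s : ℤ × ℕ × ℕ) :
    l.foldl (fun v i => (s5X i).toLinearMap v) (s5mono s) =
      s5mono (l.foldl (fun s i => s5step i s) s) := by
  induction l generalizing s with
  | nil => rfl
  | cons a l ih =>
    simp only [List.foldl_cons]
    rw [← ih]
    congr 1
    exact s5X_mono a s

/-- The functional used to detect `s₅`. -/
noncomputable def s5ell : Module.End ℂ (MvPolynomial (Fin 2) ℂ) →ₗ[ℂ] ℂ where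
  toFun T := MvPolynomial.constantCoeff (T (s5mono (1, 1, 0)))
  map_add' _ _ := by simp
  map_smul' _ _ := by simp [MvPolynomial.smul_eq_C_mul]

theorem s5_ne : s5ell (sEnd fun i => (s5X i).toLinearMap) ≠ 0 := by
  have h : s5ell (sEnd fun i => (s5X i).toLinearMap) =
      ((∑ σ : Equiv.Perm (Fin 5), (Equiv.Perm.sign σ : ℤ) *
    s5fin ((List.ofFn fun i => σ i).foldl (fun s i => s5step i s) (1, 1, 0)) : ℤ) : ℂ) := by
    rw [sEnd, map_sum]
    push_cast
    refine Finset.sum_congr rfl fun σ _ => ?_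
    rw [map_zsmul, zsmul_eq_mul]
    congr 1
    rw [← s5mono_fin, ← s5_foldl, ← s5_prod_apply, List.map_ofFn]
    rfl
  rw [h]
  exact_mod_cast s5_compute

theorem s5_alt {A : Type*} [AddCommGroup A] [Module ℂ A] (T : Fin 5 → Module.End ℂ A)
    (t : Fin 5 → ℂ) (τ : Equiv.Perm (Fin 5)) :
    sEnd (fun i => t (τ i) • T (τ i)) =
      ((Equiv.Perm.sign τ : ℤ) : ℂ) • (∏ i, t i) • sEnd T := by
  have hscal : ∀ l : List (Fin 5), (l.map fun i => t i • T i).reverse.prod =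
      (l.map t).prod • (l.map T).reverse.prod := by
    intro l
    induction l with
    | nil => simp
    | cons a l ih =>
      simp only [List.map_cons, List.reverse_cons, List.prod_append, ih, List.prod_cons,
        List.prod_nil, mul_one, smul_mul_smul_comm, mul_comm]
  unfold sEnd
  rw [Finset.smul_sum, Finset.smul_sum]
  refine Fintype.sum_equiv (Equiv.mulLeft τ) _ _ fun σ => ?_
  have h1 := hscal (List.ofFn fun i => τ (σ i))
  simp only [List.map_ofFn, Function.comp_def] at h1
  rw [h1]
  have h2 : (List.ofFn fun i => t (τ (σ i))).prod = ∏ i, t i := by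
    rw [List.prod_ofFn]
    exact Fintype.prod_equiv (σ.trans τ) _ _ fun i => rfl
  rw [h2]
  simp only [Equiv.coe_mulLeft, Equiv.Perm.mul_apply, Equiv.Perm.sign_mul, ← Int.cast_smul_eq_zsmul ℂ,
    smul_smul]
  congr 1
  have h3 : (((Equiv.Perm.sign τ : ℤ)) : ℂ) * ((Equiv.Perm.sign τ : ℤ) : ℂ) = 1 := by
    rw [← Int.cast_mul, ← Units.val_mul, Int.units_mul_self]; simp
  push_cast
  linear_combination (-(((Equiv.Perm.sign σ : ℤ)) : ℂ) * ∏ i, t i) * h3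

/-! ### Exterior algebra -/

abbrev S5Ext := ExteriorAlgebra ℂ (Fin 5 → ℂ)

noncomputable def s5top : S5Ext →ₗ[ℂ] ℂ :=
  ExteriorAlgebra.liftAlternating fun k =>
    if h : k = 5 then h ▸ (Matrix.detRowAlternating (n := Fin 5) (R := ℂ)) else 0

theorem s5top_five (v : Fin 5 → Fin 5 → ℂ) :
    s5top (List.ofFn fun i => ExteriorAlgebra.ι ℂ (v i)).prod = Matrix.det v := by
  rw [← ExteriorAlgebra.ιMulti_apply, s5top, ExteriorAlgebra.liftAlternating_apply_ιMulti]
  rfl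

theorem s5top_ne {n : ℕ} (hn : n ≠ 5) (v : Fin n → Fin 5 → ℂ) :
    s5top (List.ofFn fun i => ExteriorAlgebra.ι ℂ (v i)).prod = 0 := by
  rw [← ExteriorAlgebra.ιMulti_apply, s5top, ExteriorAlgebra.liftAlternating_apply_ιMulti]
  simp [hn]

def s5gen : Set S5Ext :=
  {z | (∃ v, z = ExteriorAlgebra.ι ℂ v) ∨
    ∃ v w, z = ExteriorAlgebra.ι ℂ v * ExteriorAlgebra.ι ℂ w}

theorem s5_swap (v w : Fin 5 → ℂ) : (ExteriorAlgebra.ι ℂ v * ExteriorAlgebra.ι ℂ w : S5Ext) =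
    - (ExteriorAlgebra.ι ℂ w * ExteriorAlgebra.ι ℂ v) :=
  eq_neg_of_add_eq_zero_left (ExteriorAlgebra.ι_add_mul_swap v w)

theorem s5_comm2 (a b c : Fin 5 → ℂ) :
    Commute (ExteriorAlgebra.ι ℂ a * ExteriorAlgebra.ι ℂ b : S5Ext) (ExteriorAlgebra.ι ℂ c) := by
  unfold Commute SemiconjBy
  rw [mul_assoc, s5_swap b c, mul_neg, ← mul_assoc, s5_swap a c, neg_mul, neg_neg, mul_assoc]

theorem s5gen_lie {x y : S5Ext} (hx : x ∈ Submodule.span ℂ s5gen)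
    (hy : y ∈ Submodule.span ℂ s5gen) : ⁅x, y⁆ ∈ Submodule.span ℂ s5gen := by
  induction hx, hy using Submodule.span_induction₂ with
  | mem_mem x y hx hy =>
    rw [Ring.lie_def]
    rcases hx with ⟨v, rfl⟩ | ⟨v, w, rfl⟩ <;> rcases hy with ⟨v', rfl⟩ | ⟨v', w', rfl⟩
    · rw [s5_swap v' v, sub_neg_eq_add]
      exact add_mem (Submodule.subset_span (Or.inr ⟨_, _, rfl⟩))
        (Submodule.subset_span (Or.inr ⟨_, _, rfl⟩))
    · rw [(s5_comm2 v' w' v).eq, sub_self]; exact zero_mem _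
    · rw [(s5_comm2 v w v').eq, sub_self]; exact zero_mem _
    · rw [((s5_comm2 v w v').mul_right (s5_comm2 v w w')).eq, sub_self]; exact zero_mem _
  | zero_left => simp
  | zero_right => simp
  | add_left _ _ _ _ _ _ h1 h2 => rw [add_lie]; exact add_mem h1 h2
  | add_right _ _ _ _ _ _ h1 h2 => rw [lie_add]; exact add_mem h1 h2
  | smul_left _ _ _ _ _ h => rw [smul_lie]; exact Submodule.smul_mem _ _ h
  | smul_right _ _ _ _ _ h => rw [lie_smul]; exact Submodule.smul_mem _ _ h

noncomputable def s5W : LieSubalgebra ℂ S5Ext :=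
  { Submodule.span ℂ s5gen with lie_mem' := fun hx hy => s5gen_lie hx hy }

theorem s5top_W {x : S5Ext} (hx : x ∈ Submodule.span ℂ s5gen) : s5top x = 0 := by
  induction hx using Submodule.span_induction with
  | mem x hx =>
    rcases hx with ⟨v, rfl⟩ | ⟨v, w, rfl⟩
    · simpa using s5top_ne (n := 1) (by norm_num) ![v]
    · simpa using s5top_ne (n := 2) (by norm_num) ![v, w]
  | zero => simp
  | add _ _ _ _ h1 h2 => simp [h1, h2]
  | smul _ _ _ h => simp [h]

noncomputable def s5e (i : Fin 5) : S5Ext := ExteriorAlgebra.ι ℂ (Pi.single i 1)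

theorem s5top_lie (f : FreeLieAlgebra ℂ (Fin 5)) : s5top (FreeLieAlgebra.lift ℂ s5e f) = 0 := by
  have hm : ∀ i, s5e i ∈ s5W := fun i => Submodule.subset_span (Or.inl ⟨_, rfl⟩)
  have h : FreeLieAlgebra.lift ℂ s5e =
      s5W.incl.comp (FreeLieAlgebra.lift ℂ fun i => (⟨s5e i, hm i⟩ : s5W)) := by
    apply FreeLieAlgebra.hom_ext
    intro i
    simp
  rw [h]
  exact s5top_W (FreeLieAlgebra.lift ℂ (fun i => (⟨s5e i, hm i⟩ : s5W)) f).2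

/-- The free Lie algebra inside the free associative algebra. -/
noncomputable def s5assoc : FreeLieAlgebra ℂ (Fin 5) →ₗ⁅ℂ⁆ FreeAlgebra ℂ (Fin 5) :=
  FreeLieAlgebra.lift ℂ (FreeAlgebra.ι ℂ)

theorem s5assoc_lift {B : Type*} [Ring B] [Algebra ℂ B] (T : Fin 5 → B)
    (f : FreeLieAlgebra ℂ (Fin 5)) :
    FreeAlgebra.lift ℂ T (s5assoc f) = FreeLieAlgebra.lift ℂ T f := by
  have h : (FreeAlgebra.lift ℂ T).toLieHom.comp s5assoc = FreeLieAlgebra.lift ℂ T := by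
    apply FreeLieAlgebra.hom_ext
    intro i
    simp [s5assoc]
  rw [← h]
  rfl

noncomputable def s5toEnd : Vect 2 →ₗ⁅ℂ⁆ Module.End ℂ (MvPolynomial (Fin 2) ℂ) where
  toFun D := D.toLinearMap
  map_add' _ _ := rfl
  map_smul' _ _ := rfl
  map_lie' := rfl

theorem s5toEnd_lift (X : Fin 5 → Vect 2) (f : FreeLieAlgebra ℂ (Fin 5)) :
    (FreeLieAlgebra.lift ℂ X f).toLinearMap =
      FreeLieAlgebra.lift ℂ (fun i => (X i).toLinearMap) f := by
  have h : s5toEnd.comp (FreeLieAlgebra.lift ℂ X) =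
      FreeLieAlgebra.lift ℂ (fun i => (X i).toLinearMap) := by
    apply FreeLieAlgebra.hom_ext
    intro i
    simp only [LieHom.comp_apply, FreeLieAlgebra.lift_of_apply]
    rfl
  rw [← h]
  rfl

/-- The multidegree `(1,1,1,1,1)`. -/
noncomputable def s5m : Fin 5 →₀ ℕ := Finsupp.equivFunOnFinite.symm fun _ => 1

theorem s5_coeff (w : List (Fin 5)) :
    MvPolynomial.coeff s5m (w.map (MvPolynomial.X (R := ℂ))).prod =
      if ∀ i, w.count i = 1 then 1 else 0 := by
  have h : (w.map (MvPolynomial.X (R := ℂ))).prod =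
      MvPolynomial.monomial (Multiset.toFinsupp (w : Multiset (Fin 5))) 1 := by
    induction w with
    | nil => simp
    | cons a w ih =>
      rw [List.map_cons, List.prod_cons, ih, ← Multiset.cons_coe, ← Multiset.singleton_add,
        map_add, Multiset.toFinsupp_singleton, MvPolynomial.X, MvPolynomial.monomial_mul, one_mul]
  rw [h, MvPolynomial.coeff_monomial]
  refine if_congr ?_ rfl rfl
  rw [Finsupp.ext_iff]
  simp [s5m]

theorem s5_count {w : List (Fin 5)} (hw : ∀ i, w.count i = 1) :
    ∃ σ : Equiv.Perm (Fin 5), w = List.ofFn fun i => σ i := by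
  have hnd : w.Nodup := List.nodup_iff_count_le_one.2 fun a => (hw a).le
  have hl : w.length = 5 := by
    have h1 := List.toFinset_card_of_nodup hnd
    have h2 : w.toFinset = Finset.univ := by
      ext a
      simp only [List.mem_toFinset, Finset.mem_univ, iff_true]
      exact List.count_pos_iff.1 (by rw [hw a]; norm_num)
    rw [h2] at h1
    simpa using h1.symm
  obtain ⟨g, rfl⟩ : ∃ g : Fin 5 → Fin 5, w = List.ofFn g := by
    refine ⟨fun i => w.get (i.cast hl.symm), ?_⟩
    rw [← List.ofFn_congr hl w.get]
    exact (List.ofFn_get w).symm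
  exact ⟨Equiv.ofBijective g (Finite.injective_iff_bijective.1 (List.nodup_ofFn.1 hnd)), rfl⟩

theorem s5_word {B : Type*} [Ring B] [Algebra ℂ B] (T : Fin 5 → B) (w : List (Fin 5)) :
    FreeAlgebra.lift ℂ T (w.map (FreeAlgebra.ι ℂ)).prod = (w.map T).prod := by
  rw [map_list_prod, List.map_map]
  congr 2
  ext i
  simp

theorem s5_top_word_perm (σ : Equiv.Perm (Fin 5)) :
    s5top ((List.ofFn fun i => σ i).map s5e).prod = ((Equiv.Perm.sign σ : ℤ) : ℂ) := by
  have h := s5top_five fun i => Pi.single (σ i) 1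
  rw [List.map_ofFn]
  refine h.trans ?_
  rw [← Matrix.det_permutation]
  congr 1
  ext i j
  simp [Equiv.toPEquiv, PEquiv.toMatrix, Pi.single_apply, eq_comm]

theorem s5_top_word_zero (w : List (Fin 5)) (hw : ¬ ∀ i, w.count i = 1) :
    s5top (w.map s5e).prod = 0 := by
  obtain ⟨n, g, rfl⟩ : ∃ n, ∃ g : Fin n → Fin 5, w = List.ofFn g :=
    ⟨w.length, w.get, (List.ofFn_get w).symm⟩
  rw [List.map_ofFn]
  by_cases hn : n = 5
  · subst hn
    refine (s5top_five fun i => Pi.single (g i) 1).trans ?_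
    by_cases hg : Function.Injective g
    · exfalso
      apply hw
      intro i
      apply List.count_eq_one_of_mem (List.nodup_ofFn.2 hg)
      rw [List.mem_ofFn]
      exact Finite.injective_iff_surjective.1 hg i
    · simp only [Function.Injective, not_forall] at hg
      obtain ⟨i, j, hij, hne⟩ := hg
      exact Matrix.det_zero_of_row_eq hne (by simp [hij])
  · exact s5top_ne hn fun i => Pi.single (g i) 1

theorem s5_main {B : Type*} [Ring B] [Algebra ℂ B] (T : Fin 5 → B) (l : B →ₗ[ℂ] ℂ)
    (q : FreeAlgebra ℂ (Fin 5)) :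
    ∃ P : MvPolynomial (Fin 5) ℂ,
      (∀ t : Fin 5 → ℂ, MvPolynomial.eval t P = ∑ τ : Equiv.Perm (Fin 5),
        ((Equiv.Perm.sign τ : ℤ) : ℂ) *
          l (FreeAlgebra.lift ℂ (fun i => t (τ i) • T (τ i)) q)) ∧
      MvPolynomial.coeff s5m P = s5top (FreeAlgebra.lift ℂ s5e q) *
        ∑ ρ : Equiv.Perm (Fin 5), ((Equiv.Perm.sign ρ : ℤ) : ℂ) *
          l (List.ofFn fun i => T (ρ i)).prod := by
  have hq : q ∈ Submodule.span ℂ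
      (Set.range fun w : List (Fin 5) => (w.map (FreeAlgebra.ι ℂ)).prod) := by
    have h1 : q ∈ Algebra.adjoin ℂ (Set.range (FreeAlgebra.ι ℂ (X := Fin 5))) := by
      rw [FreeAlgebra.adjoin_range_ι]; trivial
    rw [← Subalgebra.mem_toSubmodule, Algebra.adjoin_eq_span] at h1
    refine Submodule.span_mono ?_ h1
    intro x hx
    obtain ⟨L, hL, rfl⟩ := Submonoid.exists_list_of_mem_closure hx
    choose! g hg using hL
    refine ⟨L.map g, ?_⟩
    simp only [List.map_map]
    congr 1
    conv_rhs => rw [← List.map_id L]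
    exact List.map_congr_left fun y hy => hg y hy
  induction hq using Submodule.span_induction with
  | mem x hx =>
    obtain ⟨w, rfl⟩ := hx
    refine ⟨∑ τ : Equiv.Perm (Fin 5), MvPolynomial.C (((Equiv.Perm.sign τ : ℤ) : ℂ) *
      l ((w.map τ).map T).prod) * ((w.map τ).map MvPolynomial.X).prod, ?_, ?_⟩
    · intro t
      rw [map_sum]
      refine Finset.sum_congr rfl fun τ _ => ?_
      rw [s5_word, map_mul, MvPolynomial.eval_C, mul_assoc]
      congr 1
      have h : ∀ w : List (Fin 5), (w.map fun i => t (τ i) • T (τ i)).prod =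
          (MvPolynomial.eval t ((w.map τ).map MvPolynomial.X).prod) •
            ((w.map τ).map T).prod := by
        intro w
        induction w with
        | nil => simp
        | cons a w ih =>
          simp only [List.map_cons, List.prod_cons, ih, map_mul, MvPolynomial.eval_X,
            smul_mul_smul_comm]
      rw [h, map_smul, smul_eq_mul, mul_comm]
    · rw [MvPolynomial.coeff_sum, s5_word]
      simp only [MvPolynomial.coeff_C_mul, s5_coeff]
      have hc : ∀ τ : Equiv.Perm (Fin 5),
          (∀ i, (w.map τ).count i = 1) ↔ ∀ i, w.count i = 1 := by
        intro τ
        rw [← τ.forall_congr_right]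
        simp only [List.count_map_of_injective _ _ τ.injective]
      simp only [hc]
      by_cases hw : ∀ i, w.count i = 1
      · simp only [hw, implies_true, if_true, mul_one]
        obtain ⟨σ, rfl⟩ := s5_count hw
        rw [s5_top_word_perm, Finset.mul_sum]
        refine Fintype.sum_equiv (Equiv.mulRight σ) _ _ fun τ => ?_
        simp only [List.map_ofFn, Equiv.coe_mulRight, Equiv.Perm.sign_mul, Function.comp_def,
          Equiv.Perm.mul_apply]
        have h3 : (((Equiv.Perm.sign σ : ℤ)) : ℂ) * ((Equiv.Perm.sign σ : ℤ) : ℂ) = 1 := by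
          rw [← Int.cast_mul, ← Units.val_mul, Int.units_mul_self]; simp
        push_cast
        linear_combination (-(((Equiv.Perm.sign τ : ℤ)) : ℂ) *
          l (List.ofFn fun i => T (τ (σ i))).prod) * h3
      · rw [s5_top_word_zero w hw]
        simp [hw]
  | zero => exact ⟨0, by simp, by simp⟩
  | add x y _ _ hx hy =>
    obtain ⟨P, hP, hP'⟩ := hx
    obtain ⟨Q, hQ, hQ'⟩ := hy
    refine ⟨P + Q, fun t => ?_, ?_⟩
    · rw [map_add, hP, hQ, ← Finset.sum_add_distrib]
      simp only [map_add, mul_add]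
    · rw [MvPolynomial.coeff_add, hP', hQ', map_add, map_add, add_mul]
  | smul c x _ hx =>
    obtain ⟨P, hP, hP'⟩ := hx
    refine ⟨c • P, fun t => ?_, ?_⟩
    · rw [MvPolynomial.smul_eval, hP, Finset.mul_sum]
      refine Finset.sum_congr rfl fun τ _ => ?_
      rw [map_smul, map_smul, smul_eq_mul]
      ring
    · rw [MvPolynomial.coeff_smul, hP', map_smul, map_smul, smul_eq_mul, smul_eq_mul, mul_assoc]

end S5proof

/-- the 5-commutator `s₅` on divergence-free vector fields in two
variables is primitive: it is not given by any Lie polynomial. -/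
theorem stmt_8 :
    ¬ ∃ f : FreeLieAlgebra ℂ (Fin 5),
      ∀ X : Fin 5 → Vect 2, (∀ i, divg (X i) = 0) →
        (FreeLieAlgebra.lift ℂ X f).toLinearMap =
          sEnd (fun i => (X i).toLinearMap) := by
  rintro ⟨f, hf⟩
  have hne0 : ∀ T : Fin 5 → Module.End ℂ (MvPolynomial (Fin 2) ℂ),
      T = (fun i => (s5X i).toLinearMap) → s5ell (sEnd T) ≠ 0 := by
    intro T hT
    rw [hT]
    exact s5_ne
  set T : Fin 5 → Module.End ℂ (MvPolynomial (Fin 2) ℂ) := fun i => (s5X i).toLinearMap with hT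
  obtain ⟨P, hP, hP'⟩ := s5_main T s5ell (s5assoc f)
  rw [s5assoc_lift, s5top_lie, zero_mul] at hP'
  have hPeq : P = MvPolynomial.C (120 * s5ell (sEnd T)) *
      ((List.finRange 5).map MvPolynomial.X).prod := by
    apply MvPolynomial.funext
    intro t
    rw [hP]
    have hterm : ∀ τ : Equiv.Perm (Fin 5), ((Equiv.Perm.sign τ : ℤ) : ℂ) *
          s5ell (FreeAlgebra.lift ℂ (fun i => t (τ i) • T (τ i)) (s5assoc f)) =
          (∏ i, t i) * s5ell (sEnd T) := by
      intro τ
      have h := hf (fun i => t (τ i) • s5X (τ i)) (fun i => by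
        have h0 := s5X_div (τ i)
        unfold divg at h0 ⊢
        simp only [Derivation.smul_apply, Derivation.map_smul, ← Finset.smul_sum, h0, smul_zero])
      rw [s5toEnd_lift] at h
      have h' : FreeAlgebra.lift ℂ (fun i => t (τ i) • T (τ i)) (s5assoc f) =
          sEnd (fun i => t (τ i) • T (τ i)) := by
        rw [s5assoc_lift]; exact h
      rw [h', s5_alt, map_smul, map_smul, smul_eq_mul, smul_eq_mul, ← mul_assoc]
      have h3 : (((Equiv.Perm.sign τ : ℤ)) : ℂ) * ((Equiv.Perm.sign τ : ℤ) : ℂ) = 1 := by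
        rw [← Int.cast_mul, ← Units.val_mul, Int.units_mul_self]; simp
      rw [h3, one_mul]
    simp only [hterm, Finset.sum_const, Finset.card_univ, Fintype.card_perm, Fintype.card_fin]
    rw [map_mul, MvPolynomial.eval_C, map_list_prod, List.map_map]
    have h4 : ((List.finRange 5).map (MvPolynomial.eval t ∘ MvPolynomial.X)).prod = ∏ i, t i := by
      rw [← List.ofFn_eq_map, List.prod_ofFn]
      simp
    rw [h4]
    have h5 : Nat.factorial 5 = 120 := by decide
    rw [h5, nsmul_eq_mul]
    push_cast
    ring
  rw [hPeq, MvPolynomial.coeff_C_mul, s5_coeff, if_pos (by decide), mul_one] at hP'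
  have hne : s5ell (sEnd T) ≠ 0 := hne0 T hT
  have h120 : (120 : ℂ) ≠ 0 := by norm_num
  exact mul_ne_zero h120 hne hP'
end

section
/- For all divergence-free derivations X₁, …, X₅ ∈ Derivation ℂ A₂ A₂ and every divergence-free derivation Y of A₂: ∑_{σ ∈ Equiv.Perm (Fin 5)} (sign σ) • ⁅⁅⁅⁅⁅Y, X_{σ(1)}⁆, X_{σ(2)}⁆, X_{σ(3)}⁆, X_{σ(4)}⁆, X_{σ(5)}⁆ = ⁅Y, s₅(X₁, …, X₅)⁆ as ℂ-linear endomorphisms of A₂ (on the left the brackets are commutators of derivations, on the right the commutator of endomorphisms). Equivalently, ad s₅(X₁, …, X₅) = s₅(ad X₁, …, ad X₅) on divergence-free vector fields, where (Y) ad X = ⁅Y, X⁆. -/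
namespace JetCheck

/-- a letter: `(0,b)` is `∂y^b F`, `(a+1,b)` is `-∂x^a ∂y^b G`. -/
abbrev Letter := ℕ × ℕ

def lx : Letter → Letter
  | (0, b) => (1, b + 1)
  | (a + 1, b) => (a + 2, b)

def ly : Letter → Letter
  | (a, b) => (a, b + 1)

def llt (a b : Letter) : Bool := a.1.blt b.1 || (a.1.beq b.1 && a.2.blt b.2)
def leq (a b : Letter) : Bool := a.1.beq b.1 && a.2.beq b.2

structure Term where
  odd : List Letter
  ev : List Letter
  px : ℕ
  py : ℕ

abbrev Poly := List (ℤ × Term)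

def ins (a : Letter) : ℤ × List Letter → ℤ × List Letter
  | (c, []) => (c, [a])
  | (c, b :: l) =>
    if leq a b then (0, [])
    else if llt a b then (c, a :: b :: l)
    else match ins a (c, l) with
      | (c', l') => (-c', b :: l')

def srt (c : ℤ) : List Letter → ℤ × List Letter
  | [] => (c, [])
  | a :: l => ins a (srt c l)

def dL (d : Letter → Letter) : List Letter → List (List Letter)
  | [] => []
  | a :: l => (d a :: l) :: (dL d l).map (List.cons a)

def listEq : List Letter → List Letter → Bool
  | [], [] => true
  | a :: l, b :: m => leq a b && listEq l m
  | _, _ => false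

def termEq (s t : Term) : Bool :=
  s.px.beq t.px && s.py.beq t.py && listEq s.ev t.ev && listEq s.odd t.odd

def addTerm (c : ℤ) (t : Term) : Poly → Poly
  | [] => if c = 0 then [] else [(c, t)]
  | (c', t') :: p =>
    if termEq t t' then (if c + c' = 0 then p else (c + c', t') :: p)
    else (c', t') :: addTerm c t p

def addPoly (p q : Poly) : Poly := p.foldr (fun ct r => if ct.1 = 0 then r else addTerm ct.1 ct.2 r) q

def smulPoly (n : ℤ) (p : Poly) : Poly := p.map fun ct => (n * ct.1, ct.2)

/-- derivative terms of a word along `d`, without the `w * dx` term -/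
def dTerm (d : Letter → Letter) (c : ℤ) (t : Term) : Poly :=
  (dL d t.odd).map (fun l => (c, { t with odd := l })) ++
  (dL d t.ev).map (fun l => (c, { t with ev := l }))

def mulX (p : Poly) : Poly :=
  p.flatMap fun ct => (ct.1, { ct.2 with px := ct.2.px + 1 }) :: dTerm lx ct.1 ct.2
def mulY (p : Poly) : Poly :=
  p.flatMap fun ct => (ct.1, { ct.2 with py := ct.2.py + 1 }) :: dTerm ly ct.1 ct.2

def setOdd (t : Term) : ℤ × List Letter → ℤ × Term
  | (c, l) => (c, { t with odd := l })

def mulL (a : Letter) (p : Poly) : Poly :=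
  p.map fun ct => setOdd ct.2 (srt ct.1 (a :: ct.2.odd))
def mulK (a : Letter) (p : Poly) : Poly :=
  p.map fun ct => setOdd { ct.2 with ev := a :: ct.2.ev } (srt ct.1 ct.2.odd)

def mulD (p : Poly) : Poly :=
  addPoly (mulL (0, 0) (mulX p)) (addPoly (smulPoly (-1) (mulL (1, 0) (mulY p))) [])
def mulV (p : Poly) : Poly :=
  addPoly (mulK (0, 0) (mulX p)) (addPoly (smulPoly (-1) (mulK (1, 0) (mulY p))) [])

def one : Poly := [(1, ⟨[], [], 0, 0⟩)]

def d1 := mulD one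
def d2 := mulD d1
def d3 := mulD d2
def d4 := mulD d3

def t2 : Poly := addPoly (smulPoly 2 (mulV d2)) (mulD (mulV d1))
def t3 : Poly := addPoly (smulPoly (-2) (mulV d3)) (mulD t2)
def t4 : Poly := addPoly (smulPoly (-1) (mulV d4)) (mulD t3)
def total : Poly := mulD t4
theorem total_eq : total = [] := by decide +kernel

section Sound
variable {U : Type*} [Ring U]

structure Jets (L K : Letter → U) (dx dy : U) : Prop where
  sq : ∀ a, L a * L a = 0
  anti : ∀ a b, L a * L b = -(L b * L a)
  comm : ∀ a b, K b * L a = L a * K b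
  xL : ∀ a, dx * L a = L (lx a) + L a * dx
  yL : ∀ a, dy * L a = L (ly a) + L a * dy
  xK : ∀ a, dx * K a = K (lx a) + K a * dx
  yK : ∀ a, dy * K a = K (ly a) + K a * dy
  xy : dy * dx = dx * dy

variable (L K : Letter → U) (dx dy : U)

def evT (t : Term) : U := (t.odd.map L).prod * (t.ev.map K).prod * dx ^ t.px * dy ^ t.py
def evP (p : Poly) : U := (p.map fun ct => ct.1 • evT L K dx dy ct.2).sum

theorem leq_eq {a b : Letter} (h : leq a b = true) : a = b := by
  simp only [leq, Bool.and_eq_true, Nat.beq_eq] at h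
  exact Prod.ext h.1 h.2

theorem listEq_eq : ∀ {l m : List Letter}, listEq l m = true → l = m
  | [], [], _ => rfl
  | [], _ :: _, h => by simp [listEq] at h
  | _ :: _, [], h => by simp [listEq] at h
  | a :: l, b :: m, h => by
    simp only [listEq, Bool.and_eq_true] at h
    rw [leq_eq h.1, listEq_eq h.2]

theorem termEq_eq {s t : Term} (h : termEq s t = true) : s = t := by
  simp only [termEq, Bool.and_eq_true, Nat.beq_eq] at h
  obtain ⟨⟨⟨h1, h2⟩, h3⟩, h4⟩ := h
  cases s; cases t
  simp only at h1 h2 h3 h4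
  rw [h1, h2, listEq_eq h3, listEq_eq h4]

theorem evP_nil : evP L K dx dy [] = 0 := rfl
theorem evP_cons (c : ℤ) (t : Term) (p : Poly) :
    evP L K dx dy ((c, t) :: p) = c • evT L K dx dy t + evP L K dx dy p := by
  simp [evP]
theorem evP_append (p q : Poly) :
    evP L K dx dy (p ++ q) = evP L K dx dy p + evP L K dx dy q := by
  simp [evP]

theorem evP_addTerm (c : ℤ) (t : Term) (p : Poly) :
    evP L K dx dy (addTerm c t p) = c • evT L K dx dy t + evP L K dx dy p := by
  induction p with
  | nil =>
    unfold addTerm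
    split_ifs with h
    · simp [h, evP_nil]
    · rw [evP_cons]
  | cons ct p ih =>
    obtain ⟨c', t'⟩ := ct
    unfold addTerm
    split_ifs with h h2
    · rw [evP_cons, termEq_eq h, ← add_assoc, ← add_smul, h2]; simp
    · rw [evP_cons, evP_cons, termEq_eq h, ← add_assoc, ← add_smul]
    · rw [evP_cons, evP_cons, ih]; abel

theorem evP_addPoly (p q : Poly) :
    evP L K dx dy (addPoly p q) = evP L K dx dy p + evP L K dx dy q := by
  induction p with
  | nil => simp [addPoly, evP_nil]
  | cons ct p ih =>
    obtain ⟨c, t⟩ := ct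
    have : addPoly ((c, t) :: p) q = if c = 0 then addPoly p q
        else addTerm c t (addPoly p q) := rfl
    rw [this, evP_cons, add_assoc, ← ih]
    split_ifs with h
    · simp [h]
    · rw [evP_addTerm]

theorem evP_smul (n : ℤ) (p : Poly) :
    evP L K dx dy (smulPoly n p) = n • evP L K dx dy p := by
  induction p with
  | nil => simp [smulPoly, evP_nil]
  | cons ct p ih =>
    obtain ⟨c, t⟩ := ct
    have : smulPoly n ((c, t) :: p) = (n * c, t) :: smulPoly n p := rfl
    rw [this, evP_cons, ih, evP_cons, smul_add, mul_smul]

variable {L K dx dy}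

theorem ins_sound (H : Jets L K dx dy) (a : Letter) (c : ℤ) (l : List Letter) :
    (ins a (c, l)).1 • ((ins a (c, l)).2.map L).prod = c • (L a * (l.map L).prod) := by
  induction l with
  | nil => simp [ins]
  | cons b l ih =>
    unfold ins
    split_ifs with h1 h2
    · rw [leq_eq h1]
      simp [← mul_assoc, H.sq]
    · simp
    · simp only [List.map_cons, List.prod_cons]
      rw [← mul_assoc, H.anti a b, neg_smul, ← mul_smul_comm, ih]
      simp [mul_assoc, mul_smul_comm, -zsmul_eq_mul]

theorem srt_sound (H : Jets L K dx dy) (c : ℤ) (l : List Letter) :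
    (srt c l).1 • ((srt c l).2.map L).prod = c • (l.map L).prod := by
  induction l with
  | nil => simp [srt]
  | cons a l ih =>
    have : srt c (a :: l) = ins a ((srt c l).1, (srt c l).2) := rfl
    rw [this, ins_sound H, ← mul_smul_comm, ih]
    simp [mul_smul_comm, -zsmul_eq_mul]

theorem K_odd (H : Jets L K dx dy) (a : Letter) (l : List Letter) :
    K a * (l.map L).prod = (l.map L).prod * K a := by
  induction l with
  | nil => simp
  | cons b l ih =>
    simp only [List.map_cons, List.prod_cons]
    rw [← mul_assoc, H.comm, mul_assoc, ih, mul_assoc]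

theorem evP_mulL (H : Jets L K dx dy) (a : Letter) (p : Poly) :
    evP L K dx dy (mulL a p) = L a * evP L K dx dy p := by
  induction p with
  | nil => simp [mulL, evP_nil]
  | cons ct p ih =>
    obtain ⟨c, t⟩ := ct
    have h : mulL a ((c, t) :: p) = ((srt c (a :: t.odd)).1,
      { t with odd := (srt c (a :: t.odd)).2 }) :: mulL a p := rfl
    rw [h, evP_cons, ih, evP_cons, mul_add]
    congr 1
    simp only [evT]
    rw [← smul_mul_assoc, ← smul_mul_assoc, ← smul_mul_assoc, srt_sound H]
    simp [mul_assoc, mul_smul_comm, smul_mul_assoc, -zsmul_eq_mul]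

theorem evP_mulK (H : Jets L K dx dy) (a : Letter) (p : Poly) :
    evP L K dx dy (mulK a p) = K a * evP L K dx dy p := by
  induction p with
  | nil => simp [mulK, evP_nil]
  | cons ct p ih =>
    obtain ⟨c, t⟩ := ct
    have h : mulK a ((c, t) :: p) = ((srt c t.odd).1,
      { t with odd := (srt c t.odd).2, ev := a :: t.ev }) :: mulK a p := rfl
    rw [h, evP_cons, ih, evP_cons, mul_add]
    congr 1
    simp only [evT]
    rw [← smul_mul_assoc, ← smul_mul_assoc, ← smul_mul_assoc, srt_sound H, mul_smul_comm,
      ← mul_assoc, ← mul_assoc, ← mul_assoc, K_odd H]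
    simp [mul_assoc]

theorem dL_sound (M : Letter → U) (d : Letter → Letter) (z : U)
    (hz : ∀ a, z * M a = M (d a) + M a * z) (l : List Letter) :
    z * (l.map M).prod = ((dL d l).map fun m => (m.map M).prod).sum + (l.map M).prod * z := by
  induction l with
  | nil => simp [dL]
  | cons a l ih =>
    have : (List.map ((fun m => (List.map M m).prod) ∘ List.cons a) (dL d l)).sum =
        M a * ((dL d l).map fun m => (m.map M).prod).sum := by
      rw [← List.sum_map_mul_left]; simp [Function.comp_def]
    simp only [dL, List.map_cons, List.prod_cons, List.sum_cons, List.map_map]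
    rw [this, ← mul_assoc, hz, add_mul, mul_assoc (M a) z, ih]
    noncomm_ring

theorem evP_dTerm (d : Letter → Letter) (z : U)
    (hL : ∀ a, z * L a = L (d a) + L a * z) (hK : ∀ a, z * K a = K (d a) + K a * z)
    (c : ℤ) (t : Term) :
    c • (z * evT L K dx dy t) = evP L K dx dy (dTerm d c t) +
      c • ((t.odd.map L).prod * (t.ev.map K).prod * z * dx ^ t.px * dy ^ t.py) := by
  have h1 : ∀ q : List (List Letter), evP L K dx dy (q.map fun l => (c, { t with odd := l })) =
      c • ((q.map fun m => (m.map L).prod).sum *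
        ((t.ev.map K).prod * dx ^ t.px * dy ^ t.py)) := by
    intro q
    induction q with
    | nil => simp [evP_nil]
    | cons m q ih =>
      simp only [List.map_cons, evP_cons, ih, List.sum_cons, add_mul, smul_add, evT, mul_assoc]
  have h2 : ∀ q : List (List Letter), evP L K dx dy (q.map fun l => (c, { t with ev := l })) =
      c • ((t.odd.map L).prod * (q.map fun m => (m.map K).prod).sum *
        (dx ^ t.px * dy ^ t.py)) := by
    intro q
    induction q with
    | nil => simp [evP_nil]
    | cons m q ih =>
      simp only [List.map_cons, evP_cons, ih, List.sum_cons, add_mul, mul_add, smul_add, evT,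
        mul_assoc]
  rw [dTerm, evP_append, h1, h2, ← smul_add, ← smul_add]
  congr 1
  simp only [evT]
  have e1 := dL_sound L d z hL t.odd
  have e2 := dL_sound K d z hK t.ev
  simp only [← mul_assoc]
  rw [e1, add_mul, mul_assoc _ z, e2]
  noncomm_ring

theorem evP_mulX (H : Jets L K dx dy) (p : Poly) :
    evP L K dx dy (mulX p) = dx * evP L K dx dy p := by
  induction p with
  | nil => simp [mulX, evP_nil]
  | cons ct p ih =>
    obtain ⟨c, t⟩ := ct
    have h : mulX ((c, t) :: p) =
      ((c, { t with px := t.px + 1 }) :: dTerm lx c t) ++ mulX p := rfl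
    rw [h, evP_append, evP_cons, ih, evP_cons, mul_add, mul_smul_comm,
      evP_dTerm lx dx H.xL H.xK]
    congr 1
    rw [add_comm]
    simp only [evT, pow_succ', mul_assoc]

theorem evP_mulY (H : Jets L K dx dy) (p : Poly) :
    evP L K dx dy (mulY p) = dy * evP L K dx dy p := by
  induction p with
  | nil => simp [mulY, evP_nil]
  | cons ct p ih =>
    obtain ⟨c, t⟩ := ct
    have h : mulY ((c, t) :: p) =
      ((c, { t with py := t.py + 1 }) :: dTerm ly c t) ++ mulY p := rfl
    have hc : dy * dx ^ t.px = dx ^ t.px * dy := (Commute.pow_right H.xy t.px)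
    rw [h, evP_append, evP_cons, ih, evP_cons, mul_add, mul_smul_comm,
      evP_dTerm ly dy H.yL H.yK]
    congr 1
    rw [add_comm]
    simp only [evT, pow_succ']
    rw [mul_assoc _ dy, hc]
    simp only [mul_assoc]

theorem evP_mulD (H : Jets L K dx dy) (p : Poly) :
    evP L K dx dy (mulD p) = (L (0, 0) * dx - L (1, 0) * dy) * evP L K dx dy p := by
  rw [mulD, evP_addPoly, evP_addPoly, evP_smul, evP_mulL H, evP_mulL H, evP_mulX H, evP_mulY H,
    evP_nil]
  noncomm_ring

theorem evP_mulV (H : Jets L K dx dy) (p : Poly) :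
    evP L K dx dy (mulV p) = (K (0, 0) * dx - K (1, 0) * dy) * evP L K dx dy p := by
  rw [mulV, evP_addPoly, evP_addPoly, evP_smul, evP_mulK H, evP_mulK H, evP_mulX H, evP_mulY H,
    evP_nil]
  noncomm_ring

theorem evP_one : evP L K dx dy one = 1 := by
  simp [one, evP, evT]

theorem key (H : Jets L K dx dy) (D V : U) (hD : D = L (0, 0) * dx - L (1, 0) * dy)
    (hV : V = K (0, 0) * dx - K (1, 0) * dy) :
    D * (D * (D * (D * (V * D)))) - D * (V * (D * (D * (D * D))))
      - 2 * (D * (D * (V * (D * (D * D))))) + 2 * (D * (D * (D * (V * (D * D))))) = 0 := by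
  have h := congrArg (evP L K dx dy) total_eq
  rw [evP_nil] at h
  simp only [total, t4, t3, t2, d4, d3, d2, d1, evP_addPoly, evP_smul, evP_mulD H, evP_mulV H, evP_one, mul_one,
    ← hD, ← hV] at h
  rw [← h]
  simp only [zsmul_eq_mul]
  push_cast
  noncomm_ring

/-- The graded nested commutator identity. -/
theorem key' (H : Jets L K dx dy) (D V : U) (hD : D = L (0, 0) * dx - L (1, 0) * dy)
    (hV : V = K (0, 0) * dx - K (1, 0) * dy) (B1 B2 B3 B4 : U)
    (h1 : B1 = V * D - D * V) (h2 : B2 = B1 * D + D * B1) (h3 : B3 = B2 * D - D * B2)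
    (h4 : B4 = B3 * D + D * B3) :
    B4 * D - D * B4 = V * (D * D * D * D * D) - D * D * D * D * D * V := by
  have h := key H D V hD hV
  rw [← sub_eq_zero, ← h, h4, h3, h2, h1]
  noncomm_ring

end Sound
end JetCheck

noncomputable section Concrete
open JetCheck TensorProduct

abbrev A2 := MvPolynomial (Fin 2) ℂ
abbrev EA := Module.End ℂ A2
abbrev Lam := ExteriorAlgebra ℂ (Fin 5 → ℂ)
def UU : Type := EA ⊗[ℂ] Lam
instance : Ring UU := inferInstanceAs (Ring (EA ⊗[ℂ] Lam))
instance : Algebra ℂ UU := inferInstanceAs (Algebra ℂ (EA ⊗[ℂ] Lam))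

/-- pure tensors -/
def tt (T : EA) (w : Lam) : UU := T ⊗ₜ[ℂ] w

theorem tt_mul (S T : EA) (v w : Lam) : tt S v * tt T w = tt (S * T) (v * w) :=
  Algebra.TensorProduct.tmul_mul_tmul S T v w
theorem tt_add (S T : EA) (w : Lam) : tt (S + T) w = tt S w + tt T w :=
  TensorProduct.add_tmul S T w
theorem tt_neg (S : EA) (w : Lam) : tt S (-w) = -tt S w :=
  TensorProduct.tmul_neg S w
theorem tt_sub (S T : EA) (w : Lam) : tt (S - T) w = tt S w - tt T w :=
  TensorProduct.sub_tmul S T w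
theorem tt_induction {p : UU → Prop} (x : UU) (h0 : p 0) (ht : ∀ a b, p (tt a b))
    (ha : ∀ x y, p x → p y → p (x + y)) : p x :=
  TensorProduct.induction_on (motive := p) x h0 ht ha


def ee (i : Fin 5) : Lam := ExteriorAlgebra.ι ℂ (Pi.single i 1)

theorem ee_anti (i j : Fin 5) : ee i * ee j = -(ee j * ee i) :=
  eq_neg_of_add_eq_zero_left (ExteriorAlgebra.ι_add_mul_swap _ _)

/-- the coefficient of `e₀ e₁ e₂ e₃ e₄` -/
def ell : Lam →ₗ[ℂ] ℂ :=
  ExteriorAlgebra.liftAlternating fun n =>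
    if h : n = 5 then (Matrix.detRowAlternating (R := ℂ) (n := Fin 5)).domDomCongr
      (finCongr h.symm) else 0

theorem ell_apply (i : Fin 5 → Fin 5) :
    ell (ee (i 0) * ee (i 1) * ee (i 2) * ee (i 3) * ee (i 4)) =
      Matrix.det (fun r : Fin 5 => (Pi.single (i r) 1 : Fin 5 → ℂ)) := by
  have h : ee (i 0) * ee (i 1) * ee (i 2) * ee (i 3) * ee (i 4) =
      ExteriorAlgebra.ιMulti ℂ 5 (fun r : Fin 5 => (Pi.single (i r) 1 : Fin 5 → ℂ)) := by
    simp [ExteriorAlgebra.ιMulti_apply, ee, mul_assoc]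
    rfl
  rw [h, ell, ExteriorAlgebra.liftAlternating_apply_ιMulti]
  simp
  rfl

def phi0 : (EA ⊗[ℂ] Lam) →ₗ[ℂ] EA :=
  (TensorProduct.rid ℂ EA).toLinearMap ∘ₗ LinearMap.lTensor EA ell

theorem phi0_tmul (T : EA) (w : Lam) : phi0 (T ⊗ₜ[ℂ] w) = ell w • T := by
  simp [phi0]

def phi : UU →ₗ[ℂ] EA := phi0

theorem phi_tmul (T : EA) (w : Lam) : phi (tt T w) = ell w • T := phi0_tmul T w

theorem sum_fun_succ {n : ℕ} {M : Type*} [AddCommMonoid M] (f : (Fin (n + 1) → Fin 5) → M) :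
    ∑ i, f i = ∑ a : Fin 5, ∑ i' : Fin n → Fin 5, f (Matrix.vecCons a i') := by
  rw [← (Fin.consEquiv fun _ : Fin (n + 1) => Fin 5).sum_comp, Fintype.sum_prod_type]
  rfl

theorem sum_perm (f : (Fin 5 → Fin 5) → EA) :
    ∑ i : Fin 5 → Fin 5, Matrix.det (fun r : Fin 5 => (Pi.single (i r) 1 : Fin 5 → ℂ)) • f i =
      ∑ σ : Equiv.Perm (Fin 5), (Equiv.Perm.sign σ : ℤ) • f σ := by
  classical
  symm
  have hdet : ∀ σ : Equiv.Perm (Fin 5),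
      Matrix.det (fun r : Fin 5 => (Pi.single (σ r) 1 : Fin 5 → ℂ)) =
        ((Equiv.Perm.sign σ : ℤ) : ℂ) := by
    intro σ
    rw [← Matrix.det_permutation σ]
    congr 1
    ext r s
    simp [Equiv.toPEquiv_apply, PEquiv.toMatrix_apply, Pi.single_apply, eq_comm]
  refine Finset.sum_of_injOn (fun σ : Equiv.Perm (Fin 5) => (σ : Fin 5 → Fin 5))
    (fun a _ b _ h => DFunLike.coe_injective h) (fun _ _ => Finset.mem_univ _) ?_ ?_
  · intro i _ hi
    have : ¬ Function.Injective i := by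
      intro hinj
      exact hi ⟨Equiv.ofBijective i (Finite.injective_iff_bijective.mp hinj),
        by simp, by ext; simp⟩
    simp only [Function.Injective, not_forall] at this
    obtain ⟨a, b, hab, hne⟩ := this
    have h0 : Matrix.det (fun r : Fin 5 => (Pi.single (i r) 1 : Fin 5 → ℂ)) = 0 :=
      Matrix.det_zero_of_row_eq hne (by simp only [hab])
    simp only [h0, zero_smul]
  · intro σ _
    simp only [hdet]
    exact (Int.cast_smul_eq_zsmul ℂ _ _).symm

theorem phi_sum (f : (Fin 5 → Fin 5) → EA) :
    phi (∑ p : (((Fin 5 × Fin 5) × Fin 5) × Fin 5) × Fin 5,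
      tt (f ![p.1.1.1.1, p.1.1.1.2, p.1.1.2, p.1.2, p.2])
        (ee p.1.1.1.1 * ee p.1.1.1.2 * ee p.1.1.2 * ee p.1.2 * ee p.2)) =
      ∑ σ : Equiv.Perm (Fin 5), (Equiv.Perm.sign σ : ℤ) • f σ := by
  rw [← sum_perm]
  simp only [← ell_apply, sum_fun_succ, map_sum, phi_tmul, Fintype.sum_prod_type]
  simp
  rfl

section Steps
variable (T : Fin 5 → EA)

def DD : UU := ∑ i, tt (T i) (ee i)

theorem step_mul {J : Type*} [Fintype J] (B : J → EA) (w : J → Lam) :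
    (∑ j, tt (B j) (w j)) * DD T = ∑ p : J × Fin 5, tt (B p.1 * T p.2) (w p.1 * ee p.2) := by
  simp only [DD, Finset.sum_mul_sum, Fintype.sum_prod_type, tt_mul]

theorem mul_step {J : Type*} [Fintype J] (B : J → EA) (w : J → Lam) :
    DD T * (∑ j, tt (B j) (w j)) = ∑ p : J × Fin 5, tt (T p.2 * B p.1) (ee p.2 * w p.1) := by
  rw [DD, Finset.sum_mul_sum, Finset.sum_comm]
  simp only [Fintype.sum_prod_type, tt_mul]

theorem step_comm {J : Type*} [Fintype J] (B : J → EA) (w : J → Lam)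
    (h : ∀ j i, ee i * w j = w j * ee i) :
    (∑ j, tt (B j) (w j)) * DD T - DD T * (∑ j, tt (B j) (w j)) =
      ∑ p : J × Fin 5, tt ⁅B p.1, T p.2⁆ (w p.1 * ee p.2) := by
  rw [step_mul, mul_step, ← Finset.sum_sub_distrib]
  refine Finset.sum_congr rfl fun p _ => ?_
  rw [h, ← tt_sub, Ring.lie_def]

theorem step_anti {J : Type*} [Fintype J] (B : J → EA) (w : J → Lam)
    (h : ∀ j i, ee i * w j = -(w j * ee i)) :
    (∑ j, tt (B j) (w j)) * DD T + DD T * (∑ j, tt (B j) (w j)) =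
      ∑ p : J × Fin 5, tt ⁅B p.1, T p.2⁆ (w p.1 * ee p.2) := by
  rw [step_mul, mul_step, ← Finset.sum_add_distrib]
  refine Finset.sum_congr rfl fun p _ => ?_
  rw [h, tt_neg, ← sub_eq_add_neg, ← tt_sub, Ring.lie_def]

theorem step_first (V : EA) :
    (tt V 1) * DD T - DD T * (tt V 1) =
      ∑ i, tt ⁅V, T i⁆ (ee i) := by
  simp only [DD, Finset.mul_sum, Finset.sum_mul, tt_mul, one_mul,
    mul_one, ← Finset.sum_sub_distrib, ← tt_sub, Ring.lie_def]

theorem c2 (i a b : Fin 5) : ee i * (ee a * ee b) = ee a * ee b * ee i := by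
  rw [← mul_assoc, ee_anti i a, neg_mul, mul_assoc, ee_anti i b, mul_neg, neg_neg, mul_assoc]

theorem c3 (i a b c : Fin 5) : ee i * (ee a * ee b * ee c) = -(ee a * ee b * ee c * ee i) := by
  rw [← mul_assoc, c2, mul_assoc, ee_anti i c, mul_neg, mul_assoc _ (ee c)]

theorem c4 (i a b c d : Fin 5) :
    ee i * (ee a * ee b * ee c * ee d) = ee a * ee b * ee c * ee d * ee i := by
  rw [← mul_assoc, c3, neg_mul, mul_assoc _ (ee i), ee_anti i d, mul_neg, neg_neg,
    mul_assoc _ (ee d)]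

theorem D5 : DD T * DD T * DD T * DD T * DD T =
    ∑ p : (((Fin 5 × Fin 5) × Fin 5) × Fin 5) × Fin 5,
      tt (T p.1.1.1.1 * T p.1.1.1.2 * T p.1.1.2 * T p.1.2 * T p.2)
        (ee p.1.1.1.1 * ee p.1.1.1.2 * ee p.1.1.2 * ee p.1.2 * ee p.2) := by
  have h : DD T = ∑ i, tt (T i) (ee i) := rfl
  conv_lhs => rw [show DD T * DD T = (∑ i, tt (T i) (ee i)) * DD T from rfl]
  rw [step_mul, step_mul, step_mul, step_mul]

theorem phi_D5 : phi (DD T * DD T * DD T * DD T * DD T) = sEnd T := by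
  rw [D5]
  have := phi_sum fun i => T (i 0) * T (i 1) * T (i 2) * T (i 3) * T (i 4)
  refine Eq.trans this ?_
  rw [sEnd, ← (Equiv.mulRight (Fin.revPerm : Equiv.Perm (Fin 5))).sum_comp]
  refine Finset.sum_congr rfl fun σ _ => ?_
  have hs : Equiv.Perm.sign (Fin.revPerm : Equiv.Perm (Fin 5)) = 1 := by decide
  simp only [Equiv.coe_mulRight, Equiv.Perm.sign_mul, hs, mul_one]
  congr 1
  simp

theorem phi_left (V : EA) (x : UU) : phi ((tt V 1) * x) = V * phi x := by
  induction x using tt_induction with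
  | h0 => simp
  | ht a b => simp [phi_tmul, tt_mul]
  | ha a b ha hb => rw [mul_add, map_add, ha, hb, map_add, mul_add]

theorem phi_right (V : EA) (x : UU) : phi (x * (tt V 1)) = phi x * V := by
  induction x using tt_induction with
  | h0 => simp
  | ht a b => simp [phi_tmul, tt_mul]
  | ha a b ha hb => rw [add_mul, map_add, ha, hb, map_add, add_mul]

end Steps

def jx : EA := (MvPolynomial.pderiv (R := ℂ) (0 : Fin 2)).toLinearMap
def jy : EA := (MvPolynomial.pderiv (R := ℂ) (1 : Fin 2)).toLinearMap

theorem jxy : Commute jx jy := by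
  have : ⁅MvPolynomial.pderiv (R := ℂ) (0 : Fin 2), MvPolynomial.pderiv (R := ℂ) (1 : Fin 2)⁆ = 0 := by
    apply MvPolynomial.derivation_ext
    intro i
    fin_cases i <;> simp [Derivation.commutator_apply, MvPolynomial.pderiv_X, Pi.single_apply]
  apply LinearMap.ext
  intro p
  have h := DFunLike.congr_fun this p
  rw [Derivation.commutator_apply] at h
  exact sub_eq_zero.mp h

def jet (P : Vect 2) : Letter → A2
  | (0, b) => (jy ^ b) (P (MvPolynomial.X 0))
  | (a + 1, b) => -(jx ^ a) ((jy ^ b) (P (MvPolynomial.X 1)))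

theorem jet_x (P : Vect 2) (hP : divg P = 0) (l : Letter) : jx (jet P l) = jet P (lx l) := by
  obtain ⟨a, b⟩ := l
  cases a with
  | zero =>
    have h1 : jx (P (MvPolynomial.X 0)) = - jy (P (MvPolynomial.X 1)) := by
      rw [divg, Fin.sum_univ_two] at hP
      exact eq_neg_of_add_eq_zero_left hP
    have h2 : jx ((jy ^ b) (P (MvPolynomial.X 0))) = (jy ^ b) (jx (P (MvPolynomial.X 0))) :=
      DFunLike.congr_fun (jxy.pow_right b) _
    simp only [jet, lx]
    rw [h2, h1, map_neg, pow_zero, pow_succ]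
    rfl
  | succ a =>
    simp only [jet, lx]
    rw [map_neg, pow_succ']
    rfl

theorem jet_y (P : Vect 2) (l : Letter) : jy (jet P l) = jet P (ly l) := by
  obtain ⟨a, b⟩ := l
  cases a with
  | zero =>
    simp only [jet, ly]
    rw [pow_succ']
    rfl
  | succ a =>
    have h2 : ∀ q, jy ((jx ^ a) q) = (jx ^ a) (jy q) :=
      fun q => DFunLike.congr_fun (jxy.symm.pow_right a) q
    simp only [jet, ly]
    rw [map_neg, h2, pow_succ' jy]
    rfl

def mm (p : A2) : EA := LinearMap.mulLeft ℂ p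

theorem jx_mm (p : A2) : jx * mm p = mm (jx p) + mm p * jx := by
  apply LinearMap.ext
  intro q
  simp [jx, mm]
  ring

theorem jy_mm (p : A2) : jy * mm p = mm (jy p) + mm p * jy := by
  apply LinearMap.ext
  intro q
  simp [jy, mm]
  ring

theorem mm_comm (p q : A2) : mm p * mm q = mm q * mm p := by
  apply LinearMap.ext
  intro r
  simp [mm]
  ring

theorem vect_eq_s9 (P : Vect 2) : P.toLinearMap = mm (jet P (0, 0)) * jx - mm (jet P (1, 0)) * jy := by
  have : P = jet P (0, 0) • MvPolynomial.pderiv (0 : Fin 2) -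
      jet P (1, 0) • MvPolynomial.pderiv (1 : Fin 2) := by
    apply MvPolynomial.derivation_ext
    intro i
    fin_cases i <;> simp [jet, MvPolynomial.pderiv_X, Pi.single_apply]
  apply LinearMap.ext
  intro q
  exact DFunLike.congr_fun this q

def LL (X : Fin 5 → Vect 2) (l : Letter) : UU := ∑ i, tt (mm (jet (X i) l)) (ee i)
def KK (Y : Vect 2) (l : Letter) : UU := tt (mm (jet Y l)) 1

theorem jets (X : Fin 5 → Vect 2) (hX : ∀ i, divg (X i) = 0)
    (Y : Vect 2) (hY : divg Y = 0) :
    Jets (LL X) (KK Y) (tt jx 1) (tt jy 1) := by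
  have hanti : ∀ a b, LL X a * LL X b = -(LL X b * LL X a) := by
    intro a b
    simp only [LL, Finset.sum_mul_sum, tt_mul]
    rw [Finset.sum_comm, ← Finset.sum_neg_distrib]
    refine Finset.sum_congr rfl fun i _ => ?_
    rw [← Finset.sum_neg_distrib]
    refine Finset.sum_congr rfl fun j _ => ?_
    rw [ee_anti, mm_comm, tt_neg]
  refine ⟨?_, hanti, ?_, ?_, ?_, ?_, ?_, ?_⟩
  · intro a
    have h := hanti a a
    have h2 : (2 : ℂ) • (LL X a * LL X a) = 0 := by
      rw [two_smul]
      nth_rewrite 1 [h]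
      exact neg_add_cancel _
    exact (smul_eq_zero.mp h2).resolve_left two_ne_zero
  · intro a b
    simp only [LL, KK, Finset.sum_mul, Finset.mul_sum, tt_mul,
      one_mul, mul_one, mm_comm (jet Y b)]
  · intro a
    simp only [LL, Finset.sum_mul, Finset.mul_sum, tt_mul,
      one_mul, mul_one, jx_mm, tt_add, Finset.sum_add_distrib, jet_x _ (hX _)]
  · intro a
    simp only [LL, Finset.sum_mul, Finset.mul_sum, tt_mul,
      one_mul, mul_one, jy_mm, tt_add, Finset.sum_add_distrib, jet_y]
  · intro a
    simp only [KK, tt_mul,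
      one_mul, jx_mm, tt_add, jet_x _ hY]
  · intro a
    simp only [KK, tt_mul,
      one_mul, jy_mm, tt_add, jet_y]
  · simp only [tt_mul, jxy.eq]

theorem lie_toLin (P Q : Vect 2) : (⁅P, Q⁆ : Vect 2).toLinearMap = ⁅P.toLinearMap, Q.toLinearMap⁆ := by
  apply LinearMap.ext
  intro q
  exact Derivation.commutator_apply _

end Concrete

/-- `ad s₅(X₁,…,X₅) = s₅(ad X₁, …, ad X₅)` on divergence-free
vector fields in two variables. -/
theorem stmt_9 (X : Fin 5 → Vect 2) (hX : ∀ i, divg (X i) = 0)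
    (Y : Vect 2) (hY : divg Y = 0) :
    ∑ σ : Equiv.Perm (Fin 5),
      (Equiv.Perm.sign σ : ℤ) •
        (⁅⁅⁅⁅⁅Y, X (σ 0)⁆, X (σ 1)⁆, X (σ 2)⁆, X (σ 3)⁆, X (σ 4)⁆ : Vect 2).toLinearMap =
      ⁅Y.toLinearMap, sEnd (fun i => (X i).toLinearMap)⁆ := by
  have hD : DD (fun i => (X i).toLinearMap) =
      LL X (0, 0) * (tt jx 1) - LL X (1, 0) * (tt jy 1) := by
    simp only [DD, LL, Finset.sum_mul, tt_mul, mul_one,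
      ← Finset.sum_sub_distrib, ← tt_sub, ← vect_eq_s9]
  have hV : tt Y.toLinearMap 1 =
      KK Y (0, 0) * (tt jx 1) - KK Y (1, 0) * (tt jy 1) := by
    simp only [KK, tt_mul, mul_one, ← tt_sub,
      ← vect_eq_s9]
  have h := JetCheck.key' (jets X hX Y hY) _ _ hD hV _ _ _ _ rfl rfl rfl rfl
  rw [step_first, step_anti _ _ _ (fun j i => ee_anti i j),
    step_comm _ _ _ (fun j i => c2 i _ _), step_anti _ _ _ (fun j i => c3 i _ _ _),
    step_comm _ _ _ (fun j i => c4 i _ _ _ _)] at h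
  have h' := congrArg phi h
  rw [map_sub, phi_left, phi_right, phi_D5] at h'
  simp only [lie_toLin]
  rw [Ring.lie_def, ← h']
  exact (phi_sum fun i => ⁅⁅⁅⁅⁅Y.toLinearMap, (X (i 0)).toLinearMap⁆, (X (i 1)).toLinearMap⁆,
    (X (i 2)).toLinearMap⁆, (X (i 3)).toLinearMap⁆, (X (i 4)).toLinearMap⁆).symm
end
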